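/- arXiv:1602.02609 — 3 statements merged into one kernel-verified Lean document; each statement's English description precedes it below -/
import Mathlib

section
/- Let K be a compact metric space, let n be a positive integer, and let F ⊆ K be an F_σ set with dim_T F < n. Then for a generic f ∈ C(K,ℝⁿ), the set f⁻¹(y) ∩ F has at most n points for every y ∈ ℝⁿ. -/
open Set Metric Filter Topology TopologicalSpace
open scoped ENNReal NNReal

noncomputable section

universe u

/-- `indBelow n X` means that the small inductive (topological) dimension of `X`
is at most `n - 1`; in particular `indBelow 0 X` means `X = ∅`. -/
def indBelow : ℕ → ∀ (X : Type u) [TopologicalSpace X], Prop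
  | 0, X, _ => IsEmpty X
  | n + 1, X, inst =>
      letI := inst
      ∀ (x : X) (U : Set X), IsOpen U → x ∈ U →
        ∃ V : Set X, IsOpen V ∧ x ∈ V ∧ V ⊆ U ∧ indBelow n ↥(frontier V)

/-- The small inductive (topological) dimension, with values in `EReal`:
`-1` for the empty space and `⊤` if there is no finite bound. -/
def indDim (X : Type u) [TopologicalSpace X] : EReal :=
  sInf {d : EReal | ∃ n : ℕ, indBelow n X ∧ d = (n : EReal) - 1}

variable {X : Type u} [MetricSpace X]

/-- Topological dimension of a subset of a metric space. -/
def tdim (A : Set X) : EReal := indDim ↥A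

open Classical in
/-- Hausdorff dimension of a subset of a metric space,
with the convention `dim ∅ = -1`. -/
def hdim (A : Set X) : EReal := if A = ∅ then -1 else ((dimH A : ℝ≥0∞) : EReal)

/-- A `δ`-packing of `A`: a countable family of pairwise disjoint closed balls
with centers in `A` and radii at most `δ`. -/
def IsPacking (A : Set X) (δ : ℝ≥0) (s : Set (X × ℝ≥0)) : Prop :=
  s.Countable ∧ (∀ p ∈ s, p.1 ∈ A ∧ p.2 ≤ δ) ∧
    s.Pairwise fun p q => Disjoint (closedBall p.1 (p.2 : ℝ)) (closedBall q.1 (q.2 : ℝ))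

/-- The packing pre-measure `P^h_δ(A)`. -/
def packPre (h : ℝ≥0 → ℝ≥0) (A : Set X) (δ : ℝ≥0) : ℝ≥0∞ :=
  ⨆ (s : Set (X × ℝ≥0)) (_ : IsPacking A δ s), ∑' p : s, ((h p.1.2 : ℝ≥0) : ℝ≥0∞)

/-- The packing pre-measure (packing number) `P^h₀(A) = lim_{δ → 0+} P^h_δ(A)`. -/
def packPre0 (h : ℝ≥0 → ℝ≥0) (A : Set X) : ℝ≥0∞ :=
  ⨅ (δ : ℝ≥0) (_ : 0 < δ), packPre h A δ

/-- The `h`-packing measure `𝒫^h(A)`. -/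
def packMeasure (h : ℝ≥0 → ℝ≥0) (A : Set X) : ℝ≥0∞ :=
  ⨅ (c : ℕ → Set X) (_ : A = ⋃ i, c i), ∑' i, packPre0 h (c i)

open Classical in
/-- The packing dimension, with the convention `dim ∅ = -1`. -/
def pdim (A : Set X) : EReal :=
  if A = ∅ then -1
  else max 0 (⨆ (s : ℝ≥0) (_ : packMeasure (fun r => r ^ (s : ℝ)) A = ∞), ((s : ℝ) : EReal))

/-- The restriction of the packing measure `𝒫^h` to `A` is σ-finite. -/
def PackSigmaFiniteOn (h : ℝ≥0 → ℝ≥0) (A : Set X) : Prop :=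
  ∃ c : ℕ → Set X, A ⊆ ⋃ i, c i ∧ ∀ i, packMeasure h (A ∩ c i) < ∞

/-- The generalized Hausdorff measure `ℋ^h(A)` associated to a gauge function `h`. -/
def hMeasure (h : ℝ≥0 → ℝ≥0) (A : Set X) : ℝ≥0∞ :=
  ⨆ (δ : ℝ≥0) (_ : 0 < δ),
    ⨅ (c : ℕ → Set X) (_ : A ⊆ ⋃ i, c i) (_ : ∀ i, EMetric.diam (c i) ≤ (δ : ℝ≥0∞)),
      ∑' i, ((h (EMetric.diam (c i)).toNNReal : ℝ≥0) : ℝ≥0∞)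

/-- `F` is an `F_σ` subset of the subspace `A`. -/
def IsFSigmaIn (F A : Set X) : Prop :=
  ∃ C : ℕ → Set X, (∀ i, IsClosed (C i)) ∧ F = ⋃ i, C i ∩ A

/-- `d^n_*(A) = inf {dim_*(A ∖ F) : F ⊆ A is F_σ in A and dim_T F ≤ n - 1}`. -/
def dStar (dim : Set X → EReal) (n : ℕ) (A : Set X) : EReal :=
  sInf {d : EReal |
    ∃ F : Set X, IsFSigmaIn F A ∧ tdim F ≤ (n : EReal) - 1 ∧ d = dim (A \ F)}

end

/-! ### Monotonicity of the small inductive dimension -/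

theorem indBelow_succ : ∀ (m : ℕ) (Y : Type u) [TopologicalSpace Y],
    indBelow m Y → indBelow (m + 1) Y
  | 0, _, _, h => fun x _ _ _ => (h.false x).elim
  | m + 1, _, _, h => fun x U hU hx => by
      obtain ⟨V, hV, hxV, hVU, hF⟩ := h x U hU hx
      exact ⟨V, hV, hxV, hVU, indBelow_succ m _ hF⟩

theorem indBelow_mono {m n : ℕ} (hmn : m ≤ n) {Y : Type u} [TopologicalSpace Y]
    (h : indBelow m Y) : indBelow n Y := by
  induction n, hmn using Nat.le_induction with
  | base => exact h
  | succ k _ ih => exact indBelow_succ k Y ih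

theorem indBelow_of_isEmbedding : ∀ (m : ℕ) {Y Z : Type u} [TopologicalSpace Y]
    [TopologicalSpace Z] {e : Y → Z}, IsEmbedding e → indBelow m Z → indBelow m Y
  | 0, _, _, _, _, e, _, h => ⟨fun y => h.false (e y)⟩
  | m + 1, Y, Z, _, _, e, he, h => fun y U hU hy => by
      obtain ⟨U', hU', rfl⟩ := he.isOpen_iff.1 hU
      obtain ⟨V, hV, hyV, hVU, hF⟩ := h (e y) U' hU' hy
      refine ⟨e ⁻¹' V, hV.preimage he.continuous, hyV, preimage_mono hVU, ?_⟩
      have hsub : MapsTo e (frontier (e ⁻¹' V)) (frontier V) :=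
        he.continuous.frontier_preimage_subset V
      refine indBelow_of_isEmbedding m (e := hsub.restrict) ?_ hF
      exact he.restrict hsub

theorem indBelow_of_tdim_lt {n : ℕ} {Y : Type u} [MetricSpace Y] {F : Set Y}
    (h : tdim F < (n : EReal)) : indBelow n F := by
  obtain ⟨d, ⟨m, hm, rfl⟩, hd⟩ := sInf_lt_iff.1 h
  refine indBelow_mono ?_ hm
  have h1 : (((m : ℝ) - 1 : ℝ) : EReal) < ((n : ℝ) : EReal) := by
    rw [EReal.coe_sub]; exact hd
  have h2 : (m : ℝ) < n + 1 := by linarith [EReal.coe_lt_coe_iff.1 h1]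
  exact Nat.lt_succ_iff.1 (by exact_mod_cast h2)

/-! ### Tuples of real functions without common zeros -/

/-- Tuples of continuous real functions on `Y` without common zeros in `A`. -/
def noCommonZero (ι : Type*) {Y : Type*} [TopologicalSpace Y] (A : Set Y) :
    Set (ι → C(Y, ℝ)) :=
  {g | ∀ x ∈ A, ∃ i, g i x ≠ 0}

theorem isOpen_noCommonZero (ι : Type*) {Y : Type*} [TopologicalSpace Y] [CompactSpace Y]
    {A : Set Y} (hA : IsClosed A) : IsOpen (noCommonZero ι A) := by
  have hcl : IsClosed ({p : (ι → C(Y, ℝ)) × Y | p.2 ∈ A} ∩ ⋂ i, {p | p.1 i p.2 = 0}) :=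
    (hA.preimage continuous_snd).inter <|
      isClosed_iInter fun i => isClosed_eq (by fun_prop) continuous_const
  rw [← isClosed_compl_iff]
  convert isClosedMap_fst_of_compactSpace _ hcl using 1
  ext g
  simp [noCommonZero]

theorem dense_pi_iff {ι : Type*} [Fintype ι] {Y : Type*} [TopologicalSpace Y] [CompactSpace Y]
    {S : Set (ι → C(Y, ℝ))} :
    Dense S ↔ ∀ f : ι → C(Y, ℝ), ∀ ε > 0, ∃ g ∈ S, ∀ i x, |g i x - f i x| ≤ ε := by
  rw [Metric.dense_iff]
  constructor
  · intro h f ε hε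
    obtain ⟨g, hg, hgS⟩ := h f ε hε
    refine ⟨g, hgS, fun i x => ?_⟩
    rw [← Real.dist_eq]
    exact (ContinuousMap.dist_apply_le_dist x).trans
      ((dist_le_pi_dist g f i).trans (mem_ball.1 hg).le)
  · intro h f ε hε
    obtain ⟨g, hgS, hg⟩ := h f (ε / 2) (half_pos hε)
    refine ⟨g, mem_ball.2 (lt_of_le_of_lt ?_ (half_lt_self hε)), hgS⟩
    refine (dist_pi_le_iff (half_pos hε).le).2 fun i =>
      (ContinuousMap.dist_le (half_pos hε).le).2 fun x => ?_
    rw [Real.dist_eq]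
    exact hg i x

/-- A function which is close to `f` on a closed set extends to a function close to `f`. -/
theorem exists_extension_close {Y : Type*} [TopologicalSpace Y] [NormalSpace Y] {A : Set Y}
    (hA : IsClosed A) (f : C(Y, ℝ)) (h : C(A, ℝ)) {ε : ℝ} (hε : 0 ≤ ε)
    (hfh : ∀ x : A, |h x - f x| ≤ ε) :
    ∃ g : C(Y, ℝ), (∀ x, |g x - f x| ≤ ε) ∧ ∀ x : A, g x = h x := by
  obtain ⟨k, hk, hkr⟩ := (h - f.restrict A).exists_restrict_eq_forall_mem_of_closed
    (t := Icc (-ε) ε) (fun x => abs_le.1 (hfh x)) ⟨0, by simpa using hε⟩ hA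
  refine ⟨f + k, fun x => ?_, fun x => ?_⟩
  · simpa using abs_le.2 (hk x)
  · have := DFunLike.congr_fun hkr x
    simp only [ContinuousMap.restrict_apply, ContinuousMap.sub_apply] at this
    simp [this]

theorem dense_noCommonZero_of_subtype {ι : Type*} [Fintype ι] {Y : Type*} [MetricSpace Y]
    [CompactSpace Y] {A : Set Y} (hA : IsClosed A)
    (h : have := isCompact_iff_compactSpace.1 hA.isCompact
      Dense (noCommonZero ι (univ : Set A))) :
    Dense (noCommonZero ι A) := by
  have := isCompact_iff_compactSpace.1 hA.isCompact
  rw [dense_pi_iff] at h ⊢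
  intro f ε hε
  obtain ⟨g, hg, hgf⟩ := h (fun i => (f i).restrict A) ε hε
  choose k hk hkg using fun i => exists_extension_close hA (f i) (g i) hε.le (hgf i)
  refine ⟨k, fun x hx => ?_, hk⟩
  obtain ⟨i, hi⟩ := hg ⟨x, hx⟩ (mem_univ _)
  exact ⟨i, by rwa [hkg i ⟨x, hx⟩]⟩

theorem dense_noCommonZero_biUnion {ι κ : Type*} [Fintype ι] {Y : Type*} [MetricSpace Y]
    [CompactSpace Y] (t : Finset κ) {A : κ → Set Y} (hA : ∀ k, IsClosed (A k))
    (h : ∀ k ∈ t, Dense (noCommonZero ι (A k))) :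
    Dense (noCommonZero ι (⋃ k ∈ t, A k)) := by
  have : Dense (⋂ k : t, noCommonZero ι (A k)) :=
    dense_iInter_of_isOpen (fun k => isOpen_noCommonZero ι (hA k)) fun k => h k k.2
  refine this.mono fun g hg x hx => ?_
  simp only [mem_iUnion] at hx
  obtain ⟨k, hk, hx⟩ := hx
  exact mem_iInter.1 hg ⟨k, hk⟩ x hx

theorem dense_noCommonZero_comp {ι κ : Type*} [Fintype ι] [Fintype κ] {Y : Type*}
    [TopologicalSpace Y] [CompactSpace Y] {A : Set Y} (h : Dense (noCommonZero ι A)) {s : ι → κ}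
    (hs : Function.Injective s) :
    Dense {g : κ → C(Y, ℝ) | g ∘ s ∈ noCommonZero ι A} := by
  rw [dense_pi_iff] at h ⊢
  intro f ε hε
  obtain ⟨g, hg, hgf⟩ := h (f ∘ s) ε hε
  refine ⟨Function.extend s g f, ?_, fun k x => ?_⟩
  · rwa [mem_ofPred_eq, Function.extend_comp hs]
  · by_cases hk : ∃ i, s i = k
    · obtain ⟨i, rfl⟩ := hk
      rw [hs.extend_apply]
      exact hgf i x
    · rw [Function.extend_apply' _ _ _ hk]
      simpa using hε.le

theorem exists_pos_le_abs_of_mem_noCommonZero {ι : Type*} [Fintype ι] {Y : Type*}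
    [TopologicalSpace Y] [CompactSpace Y] {g : ι → C(Y, ℝ)} (hg : g ∈ noCommonZero ι univ) :
    ∃ η > 0, ∀ x, ∃ i, η ≤ |g i x| := by
  obtain ⟨η, hη, h⟩ := isCompact_univ.exists_forall_le' (f := fun x => ‖fun i => g i x‖)
    (a := 0) (by fun_prop) fun x _ => by
      obtain ⟨i, hi⟩ := hg x (mem_univ x)
      exact norm_pos_iff.2 fun h0 => hi (congrFun h0 i)
  refine ⟨η, hη, fun x => ?_⟩
  by_contra! hx
  exact (h x (mem_univ x)).not_gt ((pi_norm_lt_iff hη).2 hx)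

/-! ### Generic tuples on a space of small dimension have no common zeros -/

theorem exists_continuous_zero_iff_mem {Y : Type*} [MetricSpace Y] {A : Set Y}
    (hA : IsClosed A) :
    ∃ u : C(Y, ℝ), (∀ x, u x ∈ Icc (0 : ℝ) 1) ∧ ∀ x, u x = 0 ↔ x ∈ A := by
  rcases A.eq_empty_or_nonempty with rfl | hne
  · exact ⟨1, by simp, by simp⟩
  · refine ⟨⟨fun x => min 1 (infDist x A), by fun_prop⟩, fun x => ?_, fun x => ?_⟩
    · exact ⟨le_min zero_le_one infDist_nonneg, min_le_left _ _⟩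
    · rw [hA.mem_iff_infDist_zero hne, ContinuousMap.coe_mk]
      constructor
      · intro h
        rcases min_choice (1 : ℝ) (infDist x A) with h' | h' <;> linarith
      · intro h
        simp [h]

/-- If `f` is positive on the open set `U` and less than `ε` off `U`, then `f` can be perturbed
to a function vanishing only on the frontier of `U`. -/
theorem exists_close_zero_subset_frontier {Y : Type*} [MetricSpace Y] {U : Set Y}
    (hU : IsOpen U) (f : C(Y, ℝ)) {ε : ℝ} (hε : 0 < ε) (hpos : ∀ x ∈ U, 0 < f x)
    (hlt : ∀ x ∉ U, f x < ε) :
    ∃ g : C(Y, ℝ), (∀ x, |g x - f x| ≤ 2 * ε) ∧ ∀ x, g x = 0 → x ∈ frontier U := by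
  obtain ⟨u, hu, hu0⟩ := exists_continuous_zero_iff_mem hU.isClosed_compl
  obtain ⟨v, hv, hv0⟩ := exists_continuous_zero_iff_mem (isClosed_closure (s := U))
  refine ⟨⟨fun x => ε * (u x - v x) + (max (f x - ε) 0 + min (f x) 0), by fun_prop⟩,
    fun x => ?_, fun x hx => ?_⟩
  · have h1 : |ε * (u x - v x)| ≤ ε := by
      rw [abs_mul, abs_of_pos hε]
      have : |u x - v x| ≤ 1 := abs_le.2 ⟨by linarith [(hu x).1, (hv x).2],
        by linarith [(hu x).2, (hv x).1]⟩
      nlinarith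
    have h2 : |max (f x - ε) 0 + min (f x) 0 - f x| ≤ ε := by
      rw [abs_le]
      rcases max_cases (f x - ε) 0 with h | h <;> rcases min_cases (f x) 0 with h' | h' <;>
        constructor <;> linarith
    calc _ = |ε * (u x - v x) + (max (f x - ε) 0 + min (f x) 0 - f x)| := by
          rw [ContinuousMap.coe_mk]; ring_nf
      _ ≤ _ := by linarith [abs_add_le (ε * (u x - v x)) (max (f x - ε) 0 + min (f x) 0 - f x)]
  · rw [ContinuousMap.coe_mk] at hx
    rw [hU.frontier_eq]
    by_cases hxU : x ∈ U
    · exfalso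
      have hux : 0 < u x := lt_of_le_of_ne (hu x).1 fun h => (hu0 x).1 h.symm hxU
      have hvx : v x = 0 := (hv0 x).2 (subset_closure hxU)
      rw [hvx, min_eq_right (hpos x hxU).le, sub_zero] at hx
      linarith [mul_pos hε hux, le_max_right (f x - ε) 0]
    · refine ⟨?_, hxU⟩
      by_contra hxc
      have hux : u x = 0 := (hu0 x).2 hxU
      have hvx : 0 < v x := lt_of_le_of_ne (hv x).1 fun h => hxc ((hv0 x).1 h.symm)
      rw [hux, max_eq_right (by linarith [hlt x hxU]), zero_sub, mul_neg] at hx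
      linarith [mul_pos hε hvx, min_le_right (f x) 0]

theorem dense_noCommonZero_of_indBelow (n : ℕ) (Y : Type u) [MetricSpace Y] [CompactSpace Y]
    (hY : indBelow n Y) : Dense (noCommonZero (Fin n) (univ : Set Y)) := by
  induction n generalizing Y with
  | zero =>
    exact dense_univ.mono fun g _ x _ => (hY.false x).elim
  | succ n ih =>
    rw [dense_pi_iff]
    intro f ε hε
    have hδ : 0 < ε / 4 := by linarith
    choose V hVo hxV hVU hVF using fun x : Y => hY x {y | |f 0 y - f 0 x| < ε / 4}
      (isOpen_lt (by fun_prop) continuous_const) (by simpa using hδ)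
    obtain ⟨t, ht⟩ := CompactSpace.elim_nhds_subcover V fun x => (hVo x).mem_nhds (hxV x)
    obtain ⟨g₀, hg₀, hg₀U⟩ := exists_close_zero_subset_frontier
      (U := ⋃ x ∈ t.filter (fun x => ε / 4 ≤ f 0 x), V x)
      (isOpen_biUnion fun x _ => hVo x) (f 0) (ε := ε / 2) (by linarith)
      (fun y hy => by
        simp only [mem_iUnion, Finset.mem_filter] at hy
        obtain ⟨x, ⟨_, hx⟩, hy⟩ := hy
        have hyx : |f 0 y - f 0 x| < ε / 4 := hVU x hy
        linarith [(abs_lt.1 hyx).1])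
      (fun y hy => by
        have hyt : y ∈ ⋃ x ∈ t, V x := ht ▸ mem_univ y
        simp only [mem_iUnion, Finset.mem_filter] at hy hyt
        obtain ⟨x, hxt, hyx⟩ := hyt
        have : f 0 x < ε / 4 := by
          by_contra! h
          exact hy ⟨x, ⟨hxt, h⟩, hyx⟩
        have hyx' : |f 0 y - f 0 x| < ε / 4 := hVU x hyx
        linarith [(abs_lt.1 hyx').2])
    have hdense : Dense (noCommonZero (Fin n) (⋃ x ∈ t, frontier (V x))) :=
      dense_noCommonZero_biUnion t (fun x => isClosed_frontier) fun x _ =>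
        dense_noCommonZero_of_subtype isClosed_frontier <| by
          have := isCompact_iff_compactSpace.1 (isClosed_frontier (s := V x)).isCompact
          exact ih _ (hVF x)
    obtain ⟨g, hg, hgf⟩ := dense_pi_iff.1 hdense (fun i => f i.succ) ε hε
    refine ⟨Fin.cons g₀ g, fun x _ => ?_, fun i x => ?_⟩
    · by_cases hx : g₀ x = 0
      · have hxF := hg₀U x hx
        rw [IsOpen.frontier_eq (isOpen_iUnion fun x => isOpen_iUnion fun _ => hVo x),
          Finset.closure_biUnion] at hxF
        simp only [Set.mem_sdiff, mem_iUnion, not_exists] at hxF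
        obtain ⟨⟨z, hz, hxz⟩, hx'⟩ := hxF
        obtain ⟨i, hi⟩ := hg x (mem_biUnion (Finset.mem_filter.1 hz).1
          ((hVo z).frontier_eq ▸ ⟨hxz, hx' z hz⟩))
        exact ⟨i.succ, by simpa using hi⟩
      · exact ⟨0, by simpa using hx⟩
    · refine Fin.cases ?_ (fun i => ?_) i
      · simpa using (hg₀ x).trans (by linarith)
      · simpa using hgf i x

/-! ### Coverings by finitely many disjoint families of small closed sets -/

/-- A compact space on which generic `n`-tuples of functions have no common zero is a union of `n`
closed sets, each of which is a finite disjoint union of small closed sets; the latter are the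
fibres of a continuous map with finite range. -/
theorem exists_closed_cover_of_dense_noCommonZero {n : ℕ} {Y : Type*} [MetricSpace Y]
    [CompactSpace Y] (hd : Dense (noCommonZero (Fin n) (univ : Set Y))) {ε : ℝ} (hε : 0 < ε) :
    ∃ (t : Finset Y) (A : Fin n → Set Y) (p : Fin n → Y → t → ℝ),
      (∀ j, IsClosed (A j)) ∧ (∀ x, ∃ j, x ∈ A j) ∧ (∀ j, Continuous (p j)) ∧
      (∀ j, (p j '' A j).Finite) ∧
      ∀ j, ∀ x ∈ A j, ∀ y ∈ A j, p j x = p j y → dist x y < ε := by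
  obtain ⟨r, hr, rfl⟩ : ∃ r, 0 < r ∧ 4 * r = ε := ⟨ε / 4, by linarith, by ring⟩
  obtain ⟨t, ht⟩ := CompactSpace.elim_nhds_subcover (fun x : Y => ball x r)
    fun x => ball_mem_nhds x hr
  have hdense : Dense (⋂ s : Fin n ↪ t,
      {g : t → C(Y, ℝ) | g ∘ s ∈ noCommonZero (Fin n) univ}) :=
    dense_iInter_of_isOpen
      (fun s => (isOpen_noCommonZero (Fin n) isClosed_univ).preimage (by fun_prop))
      fun s => dense_noCommonZero_comp hd s.injective
  obtain ⟨h, hh, hhf⟩ := dense_pi_iff.1 hdense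
    (fun z => ⟨fun x => dist x z - 2 * r, by fun_prop⟩) (r / 2) (half_pos hr)
  simp only [ContinuousMap.coe_mk] at hhf
  choose η hη hηh using fun s : Fin n ↪ t =>
    exists_pos_le_abs_of_mem_noCommonZero (mem_iInter.1 hh s)
  obtain ⟨w, hw, hwr, hwη⟩ : ∃ w > 0, n * w ≤ r / 2 ∧ ∀ s, n * w ≤ η s := by
    have hlim : Tendsto (fun w : ℝ => n * w) (𝓝[>] 0) (𝓝 0) := by
      have : Tendsto (fun w : ℝ => n * w) (𝓝 0) (𝓝 (n * 0)) :=
        (continuous_const.mul continuous_id).tendsto 0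
      rw [mul_zero] at this
      exact this.mono_left nhdsWithin_le_nhds
    have h1 := hlim.eventually_le_const (half_pos hr)
    have h2 := eventually_all.2 fun s => hlim.eventually_le_const (hη s)
    obtain ⟨w, hw, h1, h2⟩ := (eventually_mem_nhdsWithin.and (h1.and h2)).exists
    exact ⟨w, hw, h1, h2⟩
  have hjn (j : Fin n) : ((j : ℕ) + 1) * w ≤ n * w :=
    mul_le_mul_of_nonneg_right (by exact_mod_cast j.2) hw.le
  refine ⟨t, fun j => ⋂ z, {x | h z x ≤ -((j + 1) * w)} ∪ {x | -(j * w) ≤ h z x},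
    fun j x z => max (-((j + 1) * w)) (min (-(j * w)) (h z x)), fun j => ?_, fun x => ?_,
    fun j => by fun_prop, fun j => ?_, fun j x hx y hy hxy => ?_⟩
  · exact isClosed_iInter fun z => (isClosed_le (by fun_prop) continuous_const).union
      (isClosed_le continuous_const (by fun_prop))
  · by_contra! hx
    simp only [mem_iInter, mem_union, mem_ofPred_eq, not_forall, not_or, not_le] at hx
    choose s hs1 hs2 using hx
    have key {i j : Fin n} (hij : s i = s j) : (i : ℕ) ≤ j := by
      have h1 := hs1 j
      have h2 := hs2 i
      rw [hij] at h2
      have h3 : (i : ℝ) < j + 1 := lt_of_mul_lt_mul_right (by linarith) hw.le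
      exact Nat.lt_succ_iff.1 (by exact_mod_cast h3)
    have hinj : Function.Injective s := fun i j hij =>
      Fin.ext (le_antisymm (key hij) (key hij.symm))
    obtain ⟨i, hi⟩ := hηh ⟨s, hinj⟩ x
    have h0 : (0 : ℝ) ≤ i * w := by positivity
    have hi' : η ⟨s, hinj⟩ ≤ |h (s i) x| := hi
    rw [abs_of_neg (by linarith [hs2 i])] at hi'
    linarith [hs1 i, hwη ⟨s, hinj⟩, hjn i]
  · refine (Set.Finite.pi' (t := fun _ : t => {-((j + 1) * w), -(j * w)})
      fun _ => Set.toFinite _).subset ?_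
    rintro _ ⟨x, hx, rfl⟩ z
    have hjw : -((j + 1) * w) ≤ -(j * w) := by linarith
    rcases mem_iInter.1 hx z with hz | hz
    · have hz : h z x ≤ -((j + 1) * w) := hz
      left
      exact max_eq_left ((min_le_right _ _).trans hz)
    · have hz : -(j * w) ≤ h z x := hz
      right
      exact (congrArg (max _) (min_eq_left hz)).trans (max_eq_right hjw)
  · have hxt : x ∈ ⋃ z ∈ t, ball z r := ht ▸ mem_univ x
    simp only [mem_iUnion, mem_ball] at hxt
    obtain ⟨z, hz, hxz⟩ := hxt
    have h1 := abs_le.1 (hhf ⟨z, hz⟩ x)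
    have h2 := abs_le.1 (hhf ⟨z, hz⟩ y)
    have h3 := congrFun hxy ⟨z, hz⟩
    have h0 : (0 : ℝ) ≤ j * w := by positivity
    simp only at h1 h2 h3
    have hxle : h ⟨z, hz⟩ x ≤ -((j + 1) * w) := by linarith [hjn j, h1.2]
    rw [max_eq_left ((min_le_right _ _).trans hxle)] at h3
    have h4 : h ⟨z, hz⟩ y < 0 := by
      rcases mem_iInter.1 hy ⟨z, hz⟩ with h5 | h5
      · have h5 : h ⟨z, hz⟩ y ≤ -((j + 1) * w) := h5
        linarith
      · have h5 : -(j * w) ≤ h ⟨z, hz⟩ y := h5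
        rw [min_eq_left h5, max_eq_right (by linarith)] at h3
        linarith
    linarith [dist_triangle_right x y z, h2.1]

/-! ### Perturbing a map to make its fibres small -/

theorem exists_injOn_close {P : Type*} {S : Set P} (hS : S.Finite) (c₀ : P → ℝ) {ε : ℝ}
    (hε : 0 < ε) : ∃ c : P → ℝ, InjOn c S ∧ ∀ p, |c p - c₀ p| ≤ ε := by
  classical
  induction S, hS using Set.Finite.induction_on with
  | empty => exact ⟨c₀, injOn_empty _, fun p => by simpa using hε.le⟩
  | @insert a S ha hS ih =>
    obtain ⟨c, hc, hcc⟩ := ih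
    obtain ⟨v, hv, hvS⟩ := (Icc_infinite (show c₀ a - ε < c₀ a + ε by linarith)).exists_notMem_finite
      (hS.image c)
    have heq : EqOn c (Function.update c a v) S := fun p hp =>
      (Function.update_of_ne (ne_of_mem_of_not_mem hp ha) _ _).symm
    refine ⟨Function.update c a v, (injOn_insert ha).2 ⟨hc.congr heq, ?_⟩, fun p => ?_⟩
    · rwa [Function.update_self, ← heq.image_eq]
    · rcases eq_or_ne p a with rfl | hp
      · rw [Function.update_self]
        exact abs_le.2 ⟨by linarith [hv.1], by linarith [hv.2]⟩
      · rw [Function.update_of_ne hp]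
        exact hcc p

theorem exists_close_fibres_small {n : ℕ} {Y : Type*} [MetricSpace Y] [CompactSpace Y]
    (hd : Dense (noCommonZero (Fin n) (univ : Set Y))) (f : Fin n → C(Y, ℝ)) {ε δ : ℝ}
    (hε : 0 < ε) (hδ : 0 < δ) :
    ∃ g : Fin n → C(Y, ℝ), (∀ j x, |g j x - f j x| ≤ ε) ∧
      ∀ x : Fin (n + 1) → Y, (∀ a b, a ≠ b → δ ≤ dist (x a) (x b)) →
        ∃ a b j, g j (x a) ≠ g j (x b) := by
  have huc (j : Fin n) : ∃ ρ > 0, ∀ x y, dist x y < ρ → |f j x - f j y| < ε / 2 := by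
    have := Metric.uniformContinuous_iff.1
      (CompactSpace.uniformContinuous_of_continuous (f j).continuous) (ε / 2) (half_pos hε)
    simpa only [Real.dist_eq] using this
  choose ρ hρ hρf using huc
  obtain ⟨σ, hσ, hσδ, hσρ⟩ : ∃ σ > 0, σ ≤ δ ∧ ∀ j, σ ≤ ρ j := by
    have h1 : ∀ᶠ σ in 𝓝[>] (0 : ℝ), σ ≤ δ :=
      nhdsWithin_le_nhds (eventually_le_nhds hδ)
    have h2 : ∀ᶠ σ in 𝓝[>] (0 : ℝ), ∀ j, σ ≤ ρ j :=
      eventually_all.2 fun j => nhdsWithin_le_nhds (eventually_le_nhds (hρ j))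
    obtain ⟨σ, hσ, h1, h2⟩ := (eventually_mem_nhdsWithin.and (h1.and h2)).exists
    exact ⟨σ, hσ, h1, h2⟩
  obtain ⟨t, A, p, hA, hcov, hp, hfin, hsmall⟩ :=
    exists_closed_cover_of_dense_noCommonZero hd hσ
  have hg (j : Fin n) : ∃ g : C(Y, ℝ), (∀ x, |g x - f j x| ≤ ε) ∧
      ∀ x ∈ A j, ∀ y ∈ A j, g x = g y → dist x y < σ := by
    have hrep (s : t → ℝ) : ∃ v : ℝ, ∀ x ∈ A j, p j x = s → |v - f j x| ≤ ε / 2 := by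
      by_cases hs : s ∈ p j '' A j
      · obtain ⟨y, hy, rfl⟩ := hs
        exact ⟨f j y, fun x hx hxy => (hρf j y x
          ((hsmall j y hy x hx hxy.symm).trans_le (hσρ j))).le⟩
      · exact ⟨0, fun x hx hxs => (hs ⟨x, hx, hxs⟩).elim⟩
    choose v hv using hrep
    obtain ⟨c, hc, hcv⟩ := exists_injOn_close (hfin j) v (half_pos hε)
    have hcont : ContinuousOn (fun x => c (p j x)) (A j) :=
      ((hfin j).continuousOn c).comp (hp j).continuousOn (mapsTo_image _ _)
    obtain ⟨g, hgf, hgc⟩ := exists_extension_close (hA j) (f j) ⟨_, hcont.domRestrict⟩ hε.le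
      fun x => by
        have h1 := hcv (p j x)
        have h2 := hv (p j x) x x.2 rfl
        have h3 := abs_sub_le (c (p j x)) (v (p j x)) (f j x)
        show |c (p j x) - f j x| ≤ ε
        linarith
    refine ⟨g, hgf, fun x hx y hy hxy => hsmall j x hx y hy ?_⟩
    have hxy' : c (p j x) = c (p j y) := (hgc ⟨x, hx⟩).symm.trans (hxy.trans (hgc ⟨y, hy⟩))
    exact hc ⟨x, hx, rfl⟩ ⟨y, hy, rfl⟩ hxy'
  choose g hgf hgA using hg
  refine ⟨g, hgf, fun x hx => ?_⟩
  choose k hk using fun a => hcov (x a)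
  obtain ⟨a, b, hab, hkab⟩ := Fintype.exists_ne_map_eq_of_card_lt k (by simp)
  refine ⟨a, b, k a, fun heq => ?_⟩
  exact (hx a b hab).not_gt
    ((hgA (k a) _ (hk a) _ (hkab ▸ hk b) heq).trans_le hσδ)

/-- Maps which do not send `n + 1` points of `C` at mutual distance at least `δ` to one point. -/
def noSeparatedFibre (n : ℕ) {K : Type*} [MetricSpace K] (C : Set K) (δ : ℝ) :
    Set C(K, Fin n → ℝ) :=
  {f | ∀ x : Fin (n + 1) → K, (∀ a, x a ∈ C) → (∀ a b, a ≠ b → δ ≤ dist (x a) (x b)) →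
    ∃ a b, f (x a) ≠ f (x b)}

theorem isOpen_noSeparatedFibre (n : ℕ) {K : Type*} [MetricSpace K] [CompactSpace K] {C : Set K}
    (hC : IsClosed C) (δ : ℝ) : IsOpen (noSeparatedFibre n C δ) := by
  have hcl : IsClosed ((⋂ a, {p : C(K, Fin n → ℝ) × (Fin (n + 1) → K) | p.2 a ∈ C}) ∩
      ((⋂ (a) (b) (_ : a ≠ b), {p | δ ≤ dist (p.2 a) (p.2 b)}) ∩
        ⋂ (a) (b), {p | p.1 (p.2 a) = p.1 (p.2 b)})) :=
    (isClosed_iInter fun a => hC.preimage (by fun_prop)).inter <|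
      (isClosed_iInter fun a => isClosed_iInter fun b => isClosed_iInter fun _ =>
        isClosed_le continuous_const (by fun_prop)).inter <|
      isClosed_iInter fun a => isClosed_iInter fun b => isClosed_eq (by fun_prop) (by fun_prop)
  rw [← isClosed_compl_iff]
  convert isClosedMap_fst_of_compactSpace _ hcl using 1
  ext f
  simp [noSeparatedFibre]

theorem dense_noSeparatedFibre {n : ℕ} {K : Type u} [MetricSpace K] [CompactSpace K] {C : Set K}
    (hC : IsClosed C) (hdim : indBelow n C) {δ : ℝ} (hδ : 0 < δ) :
    Dense (noSeparatedFibre n C δ) := by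
  have := isCompact_iff_compactSpace.1 hC.isCompact
  rw [Metric.dense_iff]
  intro f ε hε
  let φ (j : Fin n) : C(K, ℝ) := ⟨fun x => f x j, by fun_prop⟩
  obtain ⟨g, hgf, hg⟩ := exists_close_fibres_small (dense_noCommonZero_of_indBelow n C hdim)
    (fun j => (φ j).restrict C) (half_pos hε) hδ
  choose k hkf hkg using fun j => exists_extension_close hC (φ j) (g j) (half_pos hε).le (hgf j)
  refine ⟨⟨fun x j => k j x, by fun_prop⟩, mem_ball.2 (lt_of_le_of_lt ?_ (half_lt_self hε)),
    fun x hxC hx => ?_⟩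
  · refine (ContinuousMap.dist_le (half_pos hε).le).2 fun x =>
      (dist_pi_le_iff (half_pos hε).le).2 fun j => ?_
    rw [Real.dist_eq]
    exact hkf j x
  · obtain ⟨a, b, j, hab⟩ := hg (fun a => ⟨x a, hxC a⟩) hx
    refine ⟨a, b, fun heq => hab ?_⟩
    rw [← hkg, ← hkg]
    exact congrFun heq j

/-- A map in all the sets `noSeparatedFibre n (C i) δ`, where `C` is increasing, is at most
`n`-to-one on the union of the `C i`. -/
theorem encard_fibre_le_of_mem_noSeparatedFibre {n : ℕ} {K : Type*} [MetricSpace K]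
    {C : ℕ → Set K} (hC : Monotone C) {f : C(K, Fin n → ℝ)}
    (hf : ∀ i k : ℕ, f ∈ noSeparatedFibre n (C i) (1 / (k + 1))) (y : Fin n → ℝ) :
    (f ⁻¹' {y} ∩ ⋃ i, C i).encard ≤ n := by
  by_contra! hlt
  obtain ⟨t, ht, htn⟩ := exists_subset_encard_eq (k := ((n + 1 : ℕ) : ℕ∞))
    (by exact_mod_cast Order.add_one_le_of_lt hlt)
  have htfin : t.Finite := finite_of_encard_eq_coe htn
  have hcard : Nat.card t = n + 1 := by
    rw [Nat.card_coe_set_eq, Set.ncard, htn]; rfl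
  have : Finite t := htfin
  let e : Fin (n + 1) ≃ t := (Finite.equivFinOfCardEq hcard).symm
  have hC' (a : Fin (n + 1)) : ∀ᶠ i in atTop, (e a : K) ∈ C i := by
    obtain ⟨i, hi⟩ := mem_iUnion.1 (ht (e a).2).2
    exact (eventually_ge_atTop i).mono fun j hij => hC hij hi
  have hsep (a b : Fin (n + 1)) :
      ∀ᶠ k : ℕ in atTop, a ≠ b → (1 / ((k : ℝ) + 1)) ≤ dist (e a : K) (e b) := by
    by_cases hab : a = b
    · simp [hab]
    · have : 0 < dist (e a : K) (e b) :=
        dist_pos.2 fun h => hab (e.injective (Subtype.ext h))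
      exact (tendsto_one_div_add_atTop_nhds_zero_nat.eventually_le_const this).mono
        fun k hk _ => hk
  obtain ⟨i, hi⟩ := (eventually_all.2 hC').exists
  obtain ⟨k, hk⟩ := (eventually_all.2 fun a => eventually_all.2 (hsep a)).exists
  obtain ⟨a, b, hab⟩ := hf i k (fun a => e a) hi hk
  have hy (a : Fin (n + 1)) : f (e a) = y := (ht (e a).2).1
  exact hab ((hy a).trans (hy b).symm)

/-- A generic continuous map is at most `n`-to-one on a fixed `F_σ` set of topological
dimension less than `n`. -/
theorem stmt17 (n : ℕ) (hn : 0 < n) (K : Type*) [MetricSpace K] [CompactSpace K]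
    (F : Set K) (hF : IsFSigmaIn F Set.univ) (hdimF : tdim F < (n : EReal)) :
    ∀ᶠ (f : C(K, Fin n → ℝ)) in residual C(K, Fin n → ℝ),
      ∀ y : Fin n → ℝ, (⇑f ⁻¹' {y} ∩ F).encard ≤ (n : ℕ∞) := by
  obtain ⟨C, hC, rfl⟩ := hF
  simp only [inter_univ] at hdimF ⊢
  have hcl (i : ℕ) : IsClosed (accumulate C i) :=
    (finite_le_nat i).isClosed_biUnion fun j _ => hC j
  have hdim (i : ℕ) : indBelow n (accumulate C i) :=
    indBelow_of_isEmbedding n (IsEmbedding.inclusion (accumulate_subset_iUnion i))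
      (indBelow_of_tdim_lt hdimF)
  have hgen : ∀ᶠ f in residual C(K, Fin n → ℝ),
      ∀ i k : ℕ, f ∈ noSeparatedFibre n (accumulate C i) (1 / (k + 1)) :=
    eventually_countable_forall.2 fun i => eventually_countable_forall.2 fun k =>
      residual_of_dense_open (isOpen_noSeparatedFibre n (hcl i) _)
        (dense_noSeparatedFibre (hcl i) (hdim i) Nat.one_div_pos_of_nat)
  filter_upwards [hgen] with f hf y
  rw [← iUnion_accumulate]
  exact encard_fibre_le_of_mem_noSeparatedFibre monotone_accumulate hf y
end

section
/- Let m and n be positive integers with m < n, let K be a compact metric space with dim_T K = m, and let h be a gauge function with lim_{r→0+} h(r)/r^m = 0. Then for a generic f ∈ C(K,ℝⁿ) one has ℋ^h(f(K)) = 0. -/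
open Set Metric Filter Topology TopologicalSpace
open scoped ENNReal NNReal

/-- The set `A` has a cover by `k` sets, on each of which there is a uniformly locally constant
map that is `ε`-close to the identity, for every `ε > 0`. -/
def ColoredCover {X : Type u} [MetricSpace X] (k : ℕ) (A : Set X) : Prop :=
  ∀ ε : ℝ, 0 < ε → ∃ δ : ℝ, 0 < δ ∧ ∃ (C : Fin k → Set X) (l : Fin k → X → X),
    A ⊆ ⋃ c, C c ∧ (∀ c, ∀ x ∈ C c, dist x (l c x) ≤ ε) ∧
      ∀ c, ∀ x ∈ C c, ∀ y ∈ C c, dist x y < δ → l c x = l c y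

theorem ColoredCover.mono_card {X : Type u} [MetricSpace X] {k k' : ℕ} (hk : k ≤ k') {A : Set X}
    (hA : ColoredCover k A) : ColoredCover k' A := by
  intro ε hε
  obtain ⟨δ, hδ, C, l, hC, h1, h2⟩ := hA ε hε
  refine ⟨δ, hδ, fun c => if hc : c.1 < k then C ⟨c.1, hc⟩ else ∅,
    fun c => if hc : c.1 < k then l ⟨c.1, hc⟩ else id, ?_, ?_, ?_⟩
  · intro x hx
    obtain ⟨c, hc⟩ := mem_iUnion.1 (hC hx)
    refine mem_iUnion.2 ⟨Fin.castLE hk c, ?_⟩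
    simpa using hc
  · intro c x hx
    by_cases hc : c.1 < k
    · simp only [hc, dite_true] at hx ⊢
      exact h1 _ x hx
    · simp [hc] at hx
  · intro c x hx y hy hxy
    by_cases hc : c.1 < k
    · simp only [hc, dite_true] at hx hy ⊢
      exact h2 _ x hx y hy hxy
    · simp [hc] at hx

theorem ColoredCover.empty {X : Type u} [MetricSpace X] (k : ℕ) :
    ColoredCover k (∅ : Set X) := fun _ _ =>
  ⟨1, one_pos, fun _ => ∅, fun _ => id, empty_subset _, by simp, by simp⟩

open Classical in
theorem ColoredCover.union {X : Type u} [MetricSpace X] {k : ℕ} {A B : Set X}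
    (hA : ColoredCover k A) (hB : ColoredCover k B) : ColoredCover k (A ∪ B) := by
  intro ε hε
  obtain ⟨δ₀, hδ₀, C, l, hC, h1, h2⟩ := hA (ε / 2) (half_pos hε)
  obtain ⟨δ, hδ, hδδ₀, hδε⟩ : ∃ δ, 0 < δ ∧ δ ≤ δ₀ ∧ δ ≤ ε / 2 :=
    ⟨min δ₀ (ε / 2), lt_min hδ₀ (half_pos hε), min_le_left _ _, min_le_right _ _⟩
  obtain ⟨δ', hδ', C', l', hC', h1', h2'⟩ := hB (δ / 4) (by positivity)
  let g : Fin k → X → X := fun c z =>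
    if hz : ∃ s ∈ C c, dist s z < δ / 2 then l c hz.choose else z
  have hg : ∀ c z, ∀ s ∈ C c, dist s z < δ / 2 → g c z = l c s := by
    intro c z s hs hsz
    have hz : ∃ s ∈ C c, dist s z < δ / 2 := ⟨s, hs, hsz⟩
    simp only [g, dif_pos hz]
    refine h2 c _ hz.choose_spec.1 _ hs ?_
    have := dist_triangle_right hz.choose s z
    linarith [hz.choose_spec.2]
  have hgd : ∀ c z x, dist x z ≤ δ / 4 → dist x (g c z) ≤ ε := by
    intro c z x hxz
    by_cases hz : ∃ s ∈ C c, dist s z < δ / 2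
    · obtain ⟨s, hs, hsz⟩ := hz
      rw [hg c z s hs hsz]
      have e1 := dist_triangle4 x z s (l c s)
      have e2 := h1 c s hs
      rw [dist_comm z s] at e1
      linarith
    · simp only [g, dif_neg hz]
      linarith
  refine ⟨min δ' (δ / 4), lt_min hδ' (by positivity), fun c => C c ∪ C' c,
    fun c x => if x ∈ C c then l c x else g c (l' c x), ?_, ?_, ?_⟩
  · rw [iUnion_union_distrib]
    exact union_subset_union hC hC'
  · intro c x hx
    dsimp only
    split_ifs with h
    · linarith [h1 c x h]
    · exact hgd c _ x (h1' c x (hx.resolve_left h))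
  · have key : ∀ c, ∀ x ∈ C c, ∀ y ∈ C' c, dist x y < δ / 4 → l c x = g c (l' c y) := by
      intro c x hx y hy hxy
      refine (hg c _ x hx ?_).symm
      have := dist_triangle x y (l' c y)
      linarith [h1' c y hy]
    intro c x hx y hy hxy
    have hxy1 := hxy.trans_le (min_le_left _ _)
    have hxy2 := hxy.trans_le (min_le_right _ _)
    dsimp only
    split_ifs with hx' hy' hy'
    · exact h2 c x hx' y hy' (by linarith)
    · exact key c x hx' y (hy.resolve_left hy') hxy2
    · exact (key c y hy' x (hx.resolve_left hx') (by rwa [dist_comm])).symm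
    · rw [h2' c x (hx.resolve_left hx') y (hy.resolve_left hy') hxy1]

theorem ColoredCover.biUnion {X : Type u} [MetricSpace X] {k : ℕ} {ι : Type*} (t : Finset ι)
    (F : ι → Set X) (hF : ∀ i ∈ t, ColoredCover k (F i)) : ColoredCover k (⋃ i ∈ t, F i) := by
  classical
  induction t using Finset.induction_on with
  | empty => simpa using ColoredCover.empty k
  | insert a s _ ih =>
    rw [Finset.set_biUnion_insert]
    exact (hF a (Finset.mem_insert_self _ _)).union
      (ih fun i hi => hF i (Finset.mem_insert_of_mem hi))

open Classical in
theorem ColoredCover.of_subtype {X : Type u} [MetricSpace X] {k : ℕ} {F : Set X}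
    (hF : ColoredCover k (univ : Set F)) : ColoredCover k F := by
  intro ε hε
  obtain ⟨δ, hδ, C, l, hC, h1, h2⟩ := hF ε hε
  refine ⟨δ, hδ, fun c => Subtype.val '' C c,
    fun c x => if hx : x ∈ F then (l c ⟨x, hx⟩ : X) else x, ?_, ?_, ?_⟩
  · intro x hx
    obtain ⟨c, hc⟩ := mem_iUnion.1 (hC (mem_univ (⟨x, hx⟩ : F)))
    exact mem_iUnion.2 ⟨c, _, hc, rfl⟩
  · rintro c _ ⟨x, hx, rfl⟩
    simpa [Subtype.dist_eq] using h1 c x hx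
  · rintro c _ ⟨x, hx, rfl⟩ _ ⟨y, hy, rfl⟩ hxy
    simpa using congrArg Subtype.val (h2 c x hx y hy hxy)

/-- A uniformly locally constant map close to the identity extends to a thickening. -/
theorem exists_extend_thickening {X : Type u} [MetricSpace X] {δ ε : ℝ} {C : Set X} {l : X → X}
    (h1 : ∀ x ∈ C, dist x (l x) ≤ ε) (h2 : ∀ x ∈ C, ∀ y ∈ C, dist x y < δ → l x = l y) :
    ∃ l' : X → X, (∀ x ∈ thickening (δ / 3) C, dist x (l' x) ≤ ε + δ / 3) ∧
      ∀ x ∈ thickening (δ / 3) C, ∀ y ∈ thickening (δ / 3) C, dist x y < δ / 3 → l' x = l' y := by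
  have hs : ∀ x : X, ∃ s, x ∈ thickening (δ / 3) C → s ∈ C ∧ dist x s < δ / 3 := by
    intro x
    by_cases hx : x ∈ thickening (δ / 3) C
    · obtain ⟨s, hs, hxs⟩ := mem_thickening_iff.1 hx
      exact ⟨s, fun _ => ⟨hs, hxs⟩⟩
    · exact ⟨x, fun h => absurd h hx⟩
  choose s hs using hs
  refine ⟨fun x => l (s x), fun x hx => ?_, fun x hx y hy hxy => ?_⟩
  · have := dist_triangle x (s x) (l (s x))
    linarith [h1 _ (hs x hx).1, (hs x hx).2]
  · refine h2 _ (hs x hx).1 _ (hs y hy).1 ?_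
    have := dist_triangle4 (s x) x y (s y)
    rw [dist_comm (s x) x] at this
    linarith [(hs x hx).2, (hs y hy).2]

/-- Points of a compact set missing the frontiers of finitely many open sets lie in the same
members of this family as soon as they are close enough. -/
theorem exists_forall_mem_iff_of_dist_lt {X : Type u} [MetricSpace X] {Z : Set X}
    (hZ : IsCompact Z) (t : Finset X) (V : X → Set X) (hV : ∀ a ∈ t, IsOpen (V a))
    (hd : ∀ a ∈ t, Disjoint Z (frontier (V a))) :
    ∃ δ : ℝ, 0 < δ ∧ ∀ a ∈ t, ∀ x ∈ Z, ∀ y, dist x y < δ → (x ∈ V a ↔ y ∈ V a) := by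
  classical
  induction t using Finset.induction_on with
  | empty => exact ⟨1, one_pos, by simp⟩
  | insert a s _ ih =>
    obtain ⟨δ₁, hδ₁, H₁⟩ := ih (fun b hb => hV b (Finset.mem_insert_of_mem hb))
      (fun b hb => hd b (Finset.mem_insert_of_mem hb))
    have hVa := hV a (Finset.mem_insert_self _ _)
    obtain ⟨δ₂, hδ₂, H₂⟩ := lebesgue_number_lemma_of_metric (c := fun b : Bool =>
      if b then V a else (closure (V a))ᶜ) hZ
      (by
        intro b
        cases b
        · simp
        · simpa using hVa)
      (by
        intro x hx
        by_cases hxV : x ∈ V a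
        · exact mem_iUnion.2 ⟨true, by simpa using hxV⟩
        · refine mem_iUnion.2 ⟨false, ?_⟩
          have hxf := disjoint_left.1 (hd a (Finset.mem_insert_self _ _)) hx
          rw [hVa.frontier_eq] at hxf
          simpa using fun hc => hxf ⟨hc, hxV⟩)
    refine ⟨min δ₁ δ₂, lt_min hδ₁ hδ₂, fun b hb x hx y hxy => ?_⟩
    rcases Finset.mem_insert.1 hb with rfl | hb
    · obtain ⟨i, hi⟩ := H₂ x hx
      have hx' := hi (mem_ball_self hδ₂)
      have hy' := hi (mem_ball'.2 (hxy.trans_le (min_le_right _ _)))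
      cases i
      · simp only [Bool.false_eq_true, if_false] at hx' hy'
        exact iff_of_false (fun h => hx' (subset_closure h)) (fun h => hy' (subset_closure h))
      · simp only [if_true] at hx' hy'
        exact iff_of_true hx' hy'
    · exact H₁ b hb x hx y (hxy.trans_le (min_le_left _ _))

theorem coloredCover_of_indBelow (k : ℕ) : ∀ (X : Type u) [MetricSpace X] [CompactSpace X],
    indBelow k X → ColoredCover k (univ : Set X) := by
  induction k with
  | zero =>
    intro X _ _ hX
    have : IsEmpty X := hX
    rw [univ_eq_empty_iff.2 this]
    exact ColoredCover.empty 0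
  | succ k ih =>
    intro X _ _ hX ε hε
    have hX' : ∀ x : X, ∃ V : Set X, IsOpen V ∧ x ∈ V ∧ V ⊆ ball x ε ∧
        indBelow k ↥(frontier V) := fun x => hX x (ball x ε) isOpen_ball (mem_ball_self hε)
    choose V hVo hxV hVb hVi using hX'
    obtain ⟨t, ht⟩ := isCompact_univ.elim_finite_subcover V hVo
      (fun x _ => mem_iUnion.2 ⟨x, hxV x⟩)
    have hB : ColoredCover k (⋃ a ∈ t, frontier (V a)) := by
      refine ColoredCover.biUnion t _ fun a _ => ColoredCover.of_subtype ?_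
      have : CompactSpace ↥(frontier (V a)) :=
        isCompact_iff_compactSpace.1 isClosed_frontier.isCompact
      exact ih _ (hVi a)
    obtain ⟨δ₀, hδ₀, C, l, hC, h1, h2₀⟩ := hB (ε / 2) (half_pos hε)
    obtain ⟨δ, hδ, hδδ₀, hδε⟩ : ∃ δ, 0 < δ ∧ δ ≤ δ₀ ∧ δ ≤ ε / 2 :=
      ⟨min δ₀ (ε / 2), lt_min hδ₀ (half_pos hε), min_le_left _ _, min_le_right _ _⟩
    have hext := fun c => exists_extend_thickening (δ := δ) (h1 c)
      (fun x hx y hy hxy => h2₀ c x hx y hy (hxy.trans_le hδδ₀))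
    choose l' hl1 hl2 using hext
    let Z : Set X := (⋃ c, thickening (δ / 3) (C c))ᶜ
    have hZ : IsCompact Z := (isOpen_iUnion fun c => isOpen_thickening).isClosed_compl.isCompact
    obtain ⟨δ', hδ', H⟩ := exists_forall_mem_iff_of_dist_lt hZ t V (fun a _ => hVo a) (by
      intro a ha
      refine disjoint_left.2 fun x hx hxa => hx ?_
      obtain ⟨c, hc⟩ := mem_iUnion.1 (hC (mem_biUnion ha hxa))
      exact mem_iUnion.2 ⟨c, self_subset_thickening (by positivity) _ hc⟩)
    let r : X → X := fun x => @Classical.epsilon X ⟨x⟩ (fun a => a ∈ t ∧ x ∈ V a)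
    have hr : ∀ x, r x ∈ t ∧ x ∈ V (r x) := by
      intro x
      have hx := ht (mem_univ x)
      simp only [mem_iUnion, exists_prop] at hx
      exact @Classical.epsilon_spec X (fun a => a ∈ t ∧ x ∈ V a) hx
    refine ⟨min (δ / 3) δ', lt_min (by positivity) hδ',
      Fin.snoc (α := fun _ => Set X) (fun c => thickening (δ / 3) (C c)) Z,
      Fin.snoc (α := fun _ => X → X) l' r, ?_, ?_, ?_⟩
    · intro x _
      by_cases hx : x ∈ ⋃ c, thickening (δ / 3) (C c)
      · obtain ⟨c, hc⟩ := mem_iUnion.1 hx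
        exact mem_iUnion.2 ⟨c.castSucc, by simpa using hc⟩
      · exact mem_iUnion.2 ⟨Fin.last k, by simpa [Z] using hx⟩
    · intro c
      refine Fin.lastCases ?_ (fun c => ?_) c
      · intro x _
        simp only [Fin.snoc_last]
        exact (mem_ball.1 (hVb _ (hr x).2)).le
      · intro x hx
        simp only [Fin.snoc_castSucc] at hx ⊢
        linarith [hl1 c x hx]
    · intro c
      refine Fin.lastCases ?_ (fun c => ?_) c
      · intro x hx y _ hxy
        simp only [Fin.snoc_last] at hx ⊢
        have : (fun a => a ∈ t ∧ x ∈ V a) = fun a => a ∈ t ∧ y ∈ V a := by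
          funext a
          exact propext (and_congr_right fun ha => H a ha x hx y (hxy.trans_le (min_le_right _ _)))
        simp only [r, this]
      · intro x hx y hy hxy
        simp only [Fin.snoc_castSucc] at hx hy ⊢
        exact hl2 c x hx y hy (hxy.trans_le (min_le_left _ _))

theorem coloredCover_of_tdim_eq {K : Type u} [MetricSpace K] [CompactSpace K] {m : ℕ}
    (hK : tdim (univ : Set K) = (m : EReal)) : ColoredCover (m + 1) (univ : Set K) := by
  have hlt : tdim (univ : Set K) < (((m : ℝ) + 1 : ℝ) : EReal) := by
    rw [hK, ← EReal.coe_natCast, EReal.coe_lt_coe_iff]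
    exact lt_add_one _
  obtain ⟨d, ⟨k, hk, rfl⟩, hd⟩ := sInf_lt_iff.1 hlt
  have hd' : ((k : ℝ) - 1 : ℝ) < (m : ℝ) + 1 := by
    rw [← EReal.coe_natCast, ← EReal.coe_one, ← EReal.coe_sub, EReal.coe_lt_coe_iff] at hd
    exact hd
  have hkm : k < m + 2 := by
    have : (k : ℝ) < m + 2 := by linarith
    exact_mod_cast this
  have : CompactSpace ↥(univ : Set K) := isCompact_iff_compactSpace.1 isCompact_univ
  exact ((coloredCover_of_indBelow k _ hk).of_subtype).mono_card (by omega)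

/-- At small scales `r`, the set `A` is covered by `O(r ^ (-m))` balls of radius `r`. -/
def PolyCovered {E : Type*} [MetricSpace E] (m : ℕ) (A : Set E) : Prop :=
  ∃ D : ℝ, ∀ r : ℝ, 0 < r → r ≤ 1 → ∃ t : Finset E,
    (t.card : ℝ) * r ^ m ≤ D ∧ A ⊆ ⋃ x ∈ t, ball x r

theorem PolyCovered.mono {E : Type*} [MetricSpace E] {m : ℕ} {A B : Set E} (hAB : A ⊆ B)
    (hB : PolyCovered m B) : PolyCovered m A := by
  obtain ⟨D, hD⟩ := hB
  refine ⟨D, fun r hr hr1 => ?_⟩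
  obtain ⟨t, h1, h2⟩ := hD r hr hr1
  exact ⟨t, h1, hAB.trans h2⟩

theorem PolyCovered.biUnion {E : Type*} [MetricSpace E] {m : ℕ} {ι : Type*} (s : Finset ι)
    (F : ι → Set E) (hF : ∀ i ∈ s, PolyCovered m (F i)) : PolyCovered m (⋃ i ∈ s, F i) := by
  classical
  induction s using Finset.induction_on with
  | empty => exact ⟨0, fun r _ _ => ⟨∅, by simp⟩⟩
  | insert a s _ ih =>
    obtain ⟨D₁, h₁⟩ := hF a (Finset.mem_insert_self _ _)
    obtain ⟨D₂, h₂⟩ := ih fun i hi => hF i (Finset.mem_insert_of_mem hi)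
    refine ⟨D₁ + D₂, fun r hr hr1 => ?_⟩
    obtain ⟨t₁, c₁, s₁⟩ := h₁ r hr hr1
    obtain ⟨t₂, c₂, s₂⟩ := h₂ r hr hr1
    refine ⟨t₁ ∪ t₂, ?_, ?_⟩
    · have : ((t₁ ∪ t₂).card : ℝ) ≤ t₁.card + t₂.card := by
        exact_mod_cast Finset.card_union_le t₁ t₂
      have := mul_le_mul_of_nonneg_right this (pow_nonneg hr.le m)
      linarith
    · rw [Finset.set_biUnion_insert, Finset.set_biUnion_union]
      exact union_subset_union s₁ s₂

theorem polyCovered_simplex {E : Type*} [NormedAddCommGroup E] [NormedSpace ℝ E] {m : ℕ}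
    (v : Fin (m + 1) → E) :
    PolyCovered m {y | ∃ w : Fin (m + 1) → ℝ, (∀ c, 0 ≤ w c) ∧ ∑ c, w c = 1 ∧
      y = ∑ c, w c • v c} := by
  classical
  set L : ℝ := ∑ i : Fin m, ‖v i.succ - v 0‖ with hL
  have hL0 : 0 ≤ L := Finset.sum_nonneg fun i _ => norm_nonneg _
  refine ⟨(L + 3) ^ m, fun r hr hr1 => ?_⟩
  set N : ℕ := ⌊L / r⌋₊ + 1 with hN
  have hNgt : L / r < N := by
    rw [hN]
    exact_mod_cast Nat.lt_floor_add_one (L / r)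
  have hN0 : (0 : ℝ) < N := by rw [hN]; positivity
  have hLN : L / N < r := by
    rw [div_lt_iff₀ hr] at hNgt
    rw [div_lt_iff₀ hN0]
    linarith
  let pt : (Fin m → Fin (N + 1)) → E := fun a =>
    v 0 + ∑ i, ((a i : ℕ) / N : ℝ) • (v i.succ - v 0)
  refine ⟨Finset.univ.image pt, ?_, ?_⟩
  · have hcard : ((Finset.univ.image pt).card : ℝ) ≤ ((N : ℝ) + 1) ^ m := by
      have : (Finset.univ.image pt).card ≤ (N + 1) ^ m := by
        refine Finset.card_image_le.trans ?_
        simp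
      exact_mod_cast this
    calc ((Finset.univ.image pt).card : ℝ) * r ^ m ≤ ((N : ℝ) + 1) ^ m * r ^ m := by gcongr
      _ = (((N : ℝ) + 1) * r) ^ m := (mul_pow _ _ _).symm
      _ ≤ (L + 3) ^ m := by
        gcongr
        have h1 : (N : ℝ) ≤ L / r + 1 := by
          rw [hN]
          push_cast
          linarith [Nat.floor_le (div_nonneg hL0 hr.le)]
        calc ((N : ℝ) + 1) * r ≤ (L / r + 2) * r :=
            mul_le_mul_of_nonneg_right (by linarith) hr.le
          _ = L + 2 * r := by field_simp
          _ ≤ L + 3 := by linarith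
  · rintro y ⟨w, hw0, hw1, rfl⟩
    have hwle : ∀ c, w c ≤ 1 := fun c => by
      rw [← hw1]
      exact Finset.single_le_sum (fun c _ => hw0 c) (Finset.mem_univ c)
    have hfl : ∀ c, ⌊N * w c⌋₊ < N + 1 := by
      intro c
      refine Nat.lt_succ_of_le (Nat.floor_le_of_le ?_)
      nlinarith [hwle c]
    let a : Fin m → Fin (N + 1) := fun i => ⟨⌊N * w i.succ⌋₊, hfl _⟩
    refine mem_biUnion (Finset.mem_coe.2 (Finset.mem_image_of_mem pt (Finset.mem_univ a))) ?_
    have hsum : ∑ c, w c • v c = v 0 + ∑ i : Fin m, w i.succ • (v i.succ - v 0) := by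
      have h0 : w 0 = 1 - ∑ i : Fin m, w i.succ := by
        rw [← hw1, Fin.sum_univ_succ]
        ring
      rw [Fin.sum_univ_succ, h0]
      simp only [smul_sub, Finset.sum_sub_distrib, sub_smul, one_smul, Finset.sum_smul]
      abel
    rw [mem_ball, dist_eq_norm, hsum]
    have hdiff : v 0 + ∑ i : Fin m, w i.succ • (v i.succ - v 0) - pt a
        = ∑ i : Fin m, (w i.succ - (a i : ℕ) / N) • (v i.succ - v 0) := by
      simp only [pt, add_sub_add_left_eq_sub, ← Finset.sum_sub_distrib, ← sub_smul]
    rw [hdiff]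
    refine lt_of_le_of_lt ?_ hLN
    refine (norm_sum_le _ _).trans ?_
    rw [hL, Finset.sum_div]
    refine Finset.sum_le_sum fun i _ => ?_
    rw [norm_smul, div_eq_inv_mul ‖v i.succ - v 0‖]
    refine mul_le_mul_of_nonneg_right ?_ (norm_nonneg (v i.succ - v 0))
    have h1 : ((a i : ℕ) : ℝ) ≤ N * w i.succ := Nat.floor_le (mul_nonneg hN0.le (hw0 _))
    have h2 : N * w i.succ < ((a i : ℕ) : ℝ) + 1 := Nat.lt_floor_add_one _
    have e : w i.succ - ((a i : ℕ) : ℝ) / N = (N * w i.succ - (a i : ℕ)) / N := by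
      field_simp
    rw [e, Real.norm_eq_abs, abs_of_nonneg (div_nonneg (by linarith) hN0.le), div_eq_inv_mul]
    exact mul_le_of_le_one_right (by positivity) (by linarith)

/-- A colored cover yields a partition of unity with as many members as there are colors,
together with locally constant choices of points on the supports. -/
theorem ColoredCover.exists_partition {K : Type u} [MetricSpace K] {k : ℕ}
    (hK : ColoredCover k (univ : Set K)) {ε : ℝ} (hε : 0 < ε) :
    ∃ (w : Fin k → K → ℝ) (p : Fin k → K → K), (∀ c, Continuous (w c)) ∧ (∀ c x, 0 ≤ w c x) ∧
      (∀ x, ∑ c, w c x = 1) ∧ (∀ c x, w c x ≠ 0 → dist x (p c x) < ε) ∧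
      ∀ x₀, ∃ U ∈ 𝓝 x₀, ∃ a : Fin k → K, ∀ x ∈ U, ∀ c, w c x ≠ 0 → p c x = a c := by
  obtain ⟨δ₀, hδ₀, C, l, hC, h1, h2₀⟩ := hK (ε / 2) (half_pos hε)
  obtain ⟨δ, hδ, hδδ₀, hδε⟩ : ∃ δ, 0 < δ ∧ δ ≤ δ₀ ∧ δ ≤ ε / 2 :=
    ⟨min δ₀ (ε / 2), lt_min hδ₀ (half_pos hε), min_le_left _ _, min_le_right _ _⟩
  have hext := fun c => exists_extend_thickening (δ := δ) (h1 c)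
    (fun x hx y hy hxy => h2₀ c x hx y hy (hxy.trans_le hδδ₀))
  choose p hp1 hp2 using hext
  have hδ3 : 0 < δ / 3 := by positivity
  let φ : Fin k → K → ℝ := fun c x => (thickenedIndicator hδ3 (C c) x : ℝ)
  have hφc : ∀ c, Continuous (φ c) := fun c =>
    NNReal.continuous_coe.comp (thickenedIndicator hδ3 (C c)).continuous
  have hφ0 : ∀ c x, 0 ≤ φ c x := fun c x => NNReal.coe_nonneg _
  have hφt : ∀ c x, φ c x ≠ 0 → x ∈ thickening (δ / 3) (C c) := by
    intro c x hx
    by_contra hxt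
    exact hx (congrArg NNReal.toReal (thickenedIndicator_zero hδ3 (C c) hxt))
  have hpos : ∀ x, 0 < ∑ c, φ c x := by
    intro x
    obtain ⟨c, hc⟩ := mem_iUnion.1 (hC (mem_univ x))
    refine Finset.sum_pos' (fun c _ => hφ0 c x) ⟨c, Finset.mem_univ c, ?_⟩
    have h1 : φ c x = 1 := congrArg NNReal.toReal (thickenedIndicator_one hδ3 (C c) hc)
    rw [h1]
    exact one_pos
  have hwφ : ∀ c x, φ c x / ∑ c, φ c x ≠ 0 → x ∈ thickening (δ / 3) (C c) := fun c x h =>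
    hφt c x fun h0 => h (by simp [h0])
  refine ⟨fun c x => φ c x / ∑ c, φ c x, p, ?_, ?_, ?_, ?_, ?_⟩
  · exact fun c => (hφc c).div (continuous_finsetSum _ fun c _ => hφc c) fun x => (hpos x).ne'
  · exact fun c x => div_nonneg (hφ0 c x) (hpos x).le
  · intro x
    rw [← Finset.sum_div]
    exact div_self (hpos x).ne'
  · intro c x hx
    linarith [hp1 c x (hwφ c x hx)]
  · intro x₀
    have ha : ∀ c, ∃ a, ∀ x ∈ ball x₀ (δ / 6), x ∈ thickening (δ / 3) (C c) → p c x = a := by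
      intro c
      by_cases h : ∃ y ∈ ball x₀ (δ / 6), y ∈ thickening (δ / 3) (C c)
      · obtain ⟨y, hy, hyt⟩ := h
        refine ⟨p c y, fun x hx hxt => hp2 c x hxt y hyt ?_⟩
        have := dist_triangle_right x y x₀
        linarith [mem_ball.1 hx, mem_ball.1 hy]
      · exact ⟨x₀, fun x hx hxt => absurd ⟨x, hx, hxt⟩ h⟩
    choose a ha using ha
    exact ⟨ball x₀ (δ / 6), ball_mem_nhds _ (by positivity), a,
      fun x hx c hc => ha c x hx (hwφ c x hc)⟩

theorem ColoredCover.dense_polyCovered {K : Type u} [MetricSpace K] [CompactSpace K] {m : ℕ}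
    (hK : ColoredCover (m + 1) (univ : Set K)) {E : Type*} [NormedAddCommGroup E]
    [NormedSpace ℝ E] : Dense {f : C(K, E) | PolyCovered m (range f)} := by
  rw [Metric.dense_iff]
  intro f η hη
  obtain ⟨ε, hε, hf⟩ := Metric.uniformContinuous_iff.1
    (CompactSpace.uniformContinuous_of_continuous f.continuous) (η / 2) (half_pos hη)
  obtain ⟨w, p, hwc, hw0, hw1, hwp, hloc⟩ := hK.exists_partition hε
  have heq : ∀ x₀, ∃ U ∈ 𝓝 x₀, ∃ a : Fin (m + 1) → K, ∀ x ∈ U,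
      ∑ c, w c x • f (p c x) = ∑ c, w c x • f (a c) := by
    intro x₀
    obtain ⟨U, hU, a, ha⟩ := hloc x₀
    refine ⟨U, hU, a, fun x hx => Finset.sum_congr rfl fun c _ => ?_⟩
    by_cases h0 : w c x = 0
    · simp [h0]
    · rw [ha x hx c h0]
  choose U hU a ha using heq
  have hgc : Continuous fun x => ∑ c, w c x • f (p c x) := by
    refine continuous_iff_continuousAt.2 fun x₀ => ?_
    have hc : Continuous fun x => ∑ c, w c x • f (a x₀ c) :=
      continuous_finsetSum _ fun c _ => (hwc c).smul continuous_const
    exact hc.continuousAt.congr (Filter.mem_of_superset (hU x₀) fun x hx => (ha x₀ x hx).symm)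
  refine ⟨⟨_, hgc⟩, ?_, ?_⟩
  · rw [mem_ball]
    refine lt_of_le_of_lt ((ContinuousMap.dist_le (half_pos hη).le).2 fun x => ?_) (half_lt_self hη)
    have e : ∑ c, w c x • f (p c x) - f x = ∑ c, w c x • (f (p c x) - f x) := by
      simp only [smul_sub, Finset.sum_sub_distrib, ← Finset.sum_smul, hw1, one_smul]
    rw [ContinuousMap.coe_mk, dist_eq_norm, e]
    calc ‖∑ c, w c x • (f (p c x) - f x)‖ ≤ ∑ c, ‖w c x • (f (p c x) - f x)‖ := norm_sum_le _ _
      _ ≤ ∑ c, w c x * (η / 2) := by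
        refine Finset.sum_le_sum fun c _ => ?_
        rw [norm_smul, Real.norm_of_nonneg (hw0 c x)]
        by_cases h0 : w c x = 0
        · simp [h0]
        · refine mul_le_mul_of_nonneg_left ?_ (hw0 c x)
          rw [← dist_eq_norm, dist_comm]
          exact (hf (hwp c x h0)).le
      _ = η / 2 := by rw [← Finset.sum_mul, hw1, one_mul]
  · obtain ⟨t, -, ht⟩ := isCompact_univ.elim_nhds_subcover U fun x _ => hU x
    refine PolyCovered.mono ?_ (PolyCovered.biUnion t _ fun x₀ _ =>
      polyCovered_simplex fun c => f (a x₀ c))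
    rintro _ ⟨x, rfl⟩
    obtain ⟨x₀, hx₀, hx⟩ := mem_iUnion₂.1 (ht (mem_univ x))
    exact mem_biUnion hx₀ ⟨fun c => w c x, fun c => hw0 c x, hw1 x, ha x₀ x hx⟩

/-- The set `A` is covered by finitely many balls of equal radius `r ≤ η` whose total
`h`-content is at most `η`. -/
def SmallCover {E : Type*} [MetricSpace E] (h : ℝ≥0 → ℝ≥0) (η : ℝ≥0) (A : Set E) : Prop :=
  ∃ r : ℝ≥0, r ≤ η ∧ ∃ t : Finset E, t.card * h (2 * r) ≤ η ∧ A ⊆ ⋃ x ∈ t, ball x r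

theorem isOpen_smallCover {K E : Type*} [MetricSpace K] [CompactSpace K] [MetricSpace E]
    (h : ℝ≥0 → ℝ≥0) (η : ℝ≥0) : IsOpen {f : C(K, E) | SmallCover h η (range f)} := by
  rw [isOpen_iff_mem_nhds]
  rintro f ⟨r, hr, t, ht, hf⟩
  have ho : IsOpen {g : C(K, E) | MapsTo g univ (⋃ x ∈ t, ball x (r : ℝ))} :=
    ContinuousMap.isOpen_setOfPred_mapsTo isCompact_univ
      (isOpen_biUnion fun x _ => isOpen_ball)
  refine Filter.mem_of_superset (ho.mem_nhds fun x _ => hf (mem_range_self x)) fun g hg => ?_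
  refine ⟨r, hr, t, ht, ?_⟩
  rintro _ ⟨x, rfl⟩
  exact hg (mem_univ x)

theorem PolyCovered.smallCover {E : Type*} [MetricSpace E] {m : ℕ} {A : Set E}
    (hA : PolyCovered m A) {h : ℝ≥0 → ℝ≥0}
    (hlim : Tendsto (fun r : ℝ≥0 => (h r : ℝ) / (r : ℝ) ^ m) (𝓝[>] 0) (𝓝 0))
    {η : ℝ≥0} (hη : 0 < η) : SmallCover h η A := by
  obtain ⟨D, hD⟩ := hA
  have hlim' : Tendsto (fun r : ℝ≥0 => D * 2 ^ m * ((h r : ℝ) / (r : ℝ) ^ m)) (𝓝[>] 0) (𝓝 0) := by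
    simpa using hlim.const_mul (D * 2 ^ m)
  have hev : ∀ᶠ r : ℝ≥0 in 𝓝[>] 0, D * 2 ^ m * ((h r : ℝ) / (r : ℝ) ^ m) < η :=
    hlim'.eventually_lt_const (by exact_mod_cast hη)
  have hev2 : ∀ᶠ r : ℝ≥0 in 𝓝[>] 0, r < min (2 * η) 2 :=
    (eventually_lt_nhds (by positivity)).filter_mono nhdsWithin_le_nhds
  obtain ⟨s, ⟨hs1, hs2⟩, hs0⟩ := ((hev.and hev2).and self_mem_nhdsWithin).exists
  have hs0' : (0 : ℝ) < s := by exact_mod_cast hs0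
  have hsη : s < 2 * η := hs2.trans_le (min_le_left _ _)
  have hs2' : s < 2 := hs2.trans_le (min_le_right _ _)
  have hs2'' : (s : ℝ) < 2 := by exact_mod_cast hs2'
  obtain ⟨t, htc, htA⟩ := hD (s / 2) (by positivity) (by linarith)
  refine ⟨s / 2, ?_, t, ?_, by simpa using htA⟩
  · rw [← NNReal.coe_le_coe]
    have : (s : ℝ) < 2 * η := by exact_mod_cast hsη
    push_cast
    linarith
  · rw [mul_div_cancel₀ s two_ne_zero, ← NNReal.coe_le_coe]
    push_cast
    refine le_trans ?_ hs1.le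
    have e : (t.card : ℝ) * h s = (t.card * (s / 2 : ℝ) ^ m) * 2 ^ m * (h s / (s : ℝ) ^ m) := by
      rw [div_pow]
      field_simp
    rw [e]
    gcongr

theorem gauge_apply_zero_of_tendsto {m : ℕ} {h : ℝ≥0 → ℝ≥0} (hmono : Monotone h)
    (hlim : Tendsto (fun r : ℝ≥0 => (h r : ℝ) / (r : ℝ) ^ m) (𝓝[>] 0) (𝓝 0)) : h 0 = 0 := by
  have hpow : Tendsto (fun r : ℝ≥0 => (r : ℝ) ^ m) (𝓝[>] 0) (𝓝 (((0 : ℝ≥0) : ℝ) ^ m)) :=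
    ((NNReal.continuous_coe.pow m).tendsto 0).mono_left nhdsWithin_le_nhds
  have hle : (h 0 : ℝ) ≤ 0 * ((0 : ℝ≥0) : ℝ) ^ m := by
    refine ge_of_tendsto (hlim.mul hpow) ?_
    filter_upwards [self_mem_nhdsWithin] with r hr
    have hr0 : (0 : ℝ) < r := by exact_mod_cast hr
    rw [div_mul_cancel₀ _ (by positivity)]
    exact_mod_cast hmono zero_le
  rw [zero_mul] at hle
  exact_mod_cast le_antisymm hle (NNReal.coe_nonneg _)

theorem hMeasure_eq_zero_of_smallCover {E : Type*} [MetricSpace E] {h : ℝ≥0 → ℝ≥0}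
    (hmono : Monotone h) (h0 : h 0 = 0) {A : Set E}
    (hA : ∀ j : ℕ, SmallCover h (1 / ((j : ℝ≥0) + 1)) A) : hMeasure h A = 0 := by
  refine le_antisymm (iSup₂_le fun δ hδ => ?_) zero_le
  refine ENNReal.le_of_forall_pos_le_add fun η hη _ => ?_
  rw [zero_add]
  obtain ⟨j, hj⟩ := exists_nat_one_div_lt (lt_min (half_pos hδ) hη)
  obtain ⟨r, hr, t, ht, hAt⟩ := hA j
  have hrδ : 2 * r ≤ δ := by
    have := (hr.trans hj.le).trans (min_le_left _ _)
    calc 2 * r ≤ 2 * (δ / 2) := by gcongr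
      _ = δ := mul_div_cancel₀ δ two_ne_zero
  let e := t.equivFin
  let c : ℕ → Set E := fun i => if hi : i < t.card then ball (e.symm ⟨i, hi⟩ : E) r else ∅
  have hdiam : ∀ i, Metric.ediam (c i) ≤ ((2 * r : ℝ≥0) : ℝ≥0∞) := by
    intro i
    by_cases hi : i < t.card
    · simp only [c, dif_pos hi]
      rw [← Metric.eball_coe]
      exact Metric.ediam_eball_le.trans_eq (by simp)
    · simp [c, dif_neg hi]
  refine iInf_le_of_le c (iInf_le_of_le ?_ (iInf_le_of_le ?_ ?_))
  · intro y hy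
    obtain ⟨x, hx, hyx⟩ := mem_iUnion₂.1 (hAt hy)
    refine mem_iUnion.2 ⟨e ⟨x, hx⟩, ?_⟩
    simpa [c] using hyx
  · exact fun i => (hdiam i).trans (by exact_mod_cast hrδ)
  · rw [tsum_eq_sum (s := Finset.range t.card)]
    · calc ∑ i ∈ Finset.range t.card, ((h (Metric.ediam (c i)).toNNReal : ℝ≥0) : ℝ≥0∞)
          ≤ ∑ i ∈ Finset.range t.card, ((h (2 * r) : ℝ≥0) : ℝ≥0∞) := by
            refine Finset.sum_le_sum fun i _ => ?_
            exact_mod_cast hmono (ENNReal.toNNReal_mono ENNReal.coe_ne_top (hdiam i))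
        _ = ((t.card * h (2 * r) : ℝ≥0) : ℝ≥0∞) := by simp
        _ ≤ η := by exact_mod_cast ht.trans (hj.le.trans (min_le_right _ _))
    · intro i hi
      have : ¬ i < t.card := by simpa using hi
      have hz : Metric.ediam (c i) = 0 := by simp [c, dif_neg this]
      change ((h (Metric.ediam (c i)).toNNReal : ℝ≥0) : ℝ≥0∞) = 0
      simp [hz, h0]

/-- If `dim_T K = m < n` and `h` is a gauge function with `h(r)/r^m → 0`, then a generic
image has zero `ℋ^h` measure. -/
theorem stmt18 (m n : ℕ) (hm : 0 < m) (hmn : m < n) (K : Type*) [MetricSpace K] [CompactSpace K]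
    (hK : tdim (Set.univ : Set K) = (m : EReal))
    (h : ℝ≥0 → ℝ≥0) (hmono : Monotone h)
    (hlim : Filter.Tendsto (fun r : ℝ≥0 => (h r : ℝ) / (r : ℝ) ^ m)
      (nhdsWithin 0 (Set.Ioi 0)) (nhds 0)) :
    ∀ᶠ (f : C(K, Fin n → ℝ)) in residual C(K, Fin n → ℝ), hMeasure h (Set.range ⇑f) = 0 := by
  have hall : ∀ j : ℕ, ∀ᶠ (f : C(K, Fin n → ℝ)) in residual C(K, Fin n → ℝ),
      SmallCover h (1 / ((j : ℝ≥0) + 1)) (range f) := by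
    intro j
    refine residual_of_dense_open (isOpen_smallCover h _) ?_
    exact (coloredCover_of_tdim_eq hK).dense_polyCovered.mono
      fun f hf => hf.smallCover hlim (by positivity)
  have hall' := (eventually_countable_forall (p := fun (f : C(K, Fin n → ℝ)) (j : ℕ) =>
    SmallCover h (1 / ((j : ℝ≥0) + 1)) (range f))).2 hall
  filter_upwards [hall'] with f hf
  exact hMeasure_eq_zero_of_smallCover hmono (gauge_apply_zero_of_tendsto hmono hlim) hf
end

section
/- Let n be a positive integer, let K be a compact metric space such that dim_T U ≥ n for every non-empty open set U ⊆ K, and let h be a gauge function with lim_{r→0+} h(r)/r^{n−1} = 0. Then for a generic f ∈ C(K,ℝⁿ) one has ℋ^h(∂f(K)) = 0, where ∂f(K) is the boundary of f(K) in ℝⁿ. -/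
open Set Metric Filter Topology TopologicalSpace
open scoped ENNReal NNReal

/-- If an open base has the property that any `n` members with distinct indices have boundaries
without a common point, then the small inductive dimension is at most `n - 1`. -/
lemma indBelow_of_basis (n : ℕ) : ∀ {Y : Type u} [TopologicalSpace Y] {ι : Type} (T : Set ι)
    (B : ι → Set Y), (∀ i ∈ T, IsOpen (B i)) →
    (∀ (y : Y) (U : Set Y), IsOpen U → y ∈ U → ∃ i ∈ T, y ∈ B i ∧ B i ⊆ U) →
    (∀ s : Finset ι, ↑s ⊆ T → s.card = n → ∀ y, ∃ i ∈ s, y ∉ frontier (B i)) →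
    indBelow n Y := by
  induction n with
  | zero =>
    intro Y _ ι T B _ _ hs
    exact ⟨fun y => by simpa using hs ∅ (by simp) rfl y⟩
  | succ n ih =>
    classical
    intro Y _ ι T B hB hbase hs x U hU hx
    obtain ⟨i, hi, hxi, hiU⟩ := hbase x U hU hx
    refine ⟨B i, hB i hi, hxi, hiU, ?_⟩
    refine ih (T \ {i}) (fun j => Subtype.val ⁻¹' B j)
      (fun j hj => (hB j hj.1).preimage continuous_subtype_val) ?_ ?_
    · rintro ⟨y, hy⟩ W hW hyW
      obtain ⟨W', hW', rfl⟩ := isOpen_induced_iff.1 hW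
      obtain ⟨j, hj, hyj, hjW⟩ := hbase y W' hW' hyW
      refine ⟨j, ⟨hj, ?_⟩, hyj, Set.preimage_mono hjW⟩
      rintro rfl
      rw [(hB _ hj).frontier_eq] at hy
      exact hy.2 hyj
    · rintro s hsT hcard ⟨y, hy⟩
      have his : i ∉ s := fun h => (hsT h).2 rfl
      obtain ⟨j, hj, hyj⟩ := hs (insert i s) (by
        rw [Finset.coe_insert]
        exact Set.insert_subset hi (hsT.trans Set.sdiff_subset)) (by
        rw [Finset.card_insert_of_notMem his, hcard]) y
      rcases Finset.mem_insert.1 hj with rfl | hj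
      · exact absurd hy hyj
      · exact ⟨j, hj, fun hfr =>
          hyj (continuous_subtype_val.frontier_preimage_subset _ hfr)⟩

lemma not_indBelow_of_le_tdim {Y : Type u} [MetricSpace Y] {n : ℕ} {U : Set Y}
    (hU : (n : EReal) ≤ tdim U) : ¬ indBelow n U := by
  intro hind
  have h1 : tdim U ≤ (n : EReal) - 1 := sInf_le ⟨n, hind, rfl⟩
  have h2 : ((n : ℝ) : EReal) ≤ (((n : ℝ) - 1 : ℝ) : EReal) := by
    push_cast
    exact hU.trans h1
  have h3 := EReal.coe_le_coe_iff.1 h2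
  linarith

open BoundedContinuousFunction in
/-- If every map into `ℝⁿ` can be approximated by maps without zeros on the closure of `U`,
then `U` has dimension at most `n - 1`. -/
lemma indBelow_of_forall_unstable {K : Type u} [MetricSpace K] [CompactSpace K] (n : ℕ)
    {U : Set K}
    (hunst : ∀ p : C(K, Fin n → ℝ), ∀ ε > 0, ∃ g, dist g p < ε ∧ ∀ x ∈ closure U, g x ≠ 0) :
    indBelow n U := by
  classical
  rcases isEmpty_or_nonempty K with hK | hK
  · exact indBelow_of_basis n (Set.univ : Set ℕ) (fun _ => Set.univ) (fun _ _ => isOpen_univ)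
      (fun y => isEmptyElim y.1) (fun s _ _ y => isEmptyElim y.1)
  let E := (ℕ × ℕ) →ᵇ C(K, ℝ)
  let O : {s : Finset (ℕ × ℕ) // s.card = n} → Set E := fun s =>
    {ψ | ∀ x ∈ closure U, ∃ i ∈ s.1, ψ i x ≠ 0}
  have hOopen : ∀ s, IsOpen (O s) := by
    intro s
    rw [isOpen_iff_mem_nhds]
    intro ψ hψ
    refine isClosed_closure.isCompact.eventually_forall_of_forall_eventually ?_
    intro x hx
    obtain ⟨i, hi, hne⟩ := hψ x hx
    have hc : Continuous fun z : E × K => z.1 i z.2 :=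
      ((continuous_eval_const i).comp continuous_fst).eval continuous_snd
    filter_upwards [hc.continuousAt.eventually_ne (x := (ψ, x)) hne] with z hz
    exact ⟨i, hi, hz⟩
  have hOdense : ∀ s, Dense (O s) := by
    rintro ⟨s, hs⟩
    rw [Metric.dense_iff]
    intro ψ ε hε
    let e : s ≃ Fin n := s.equivFinOfCardEq hs
    let p : C(K, Fin n → ℝ) := ⟨fun x j => ψ (e.symm j).1 x, by fun_prop⟩
    obtain ⟨g, hg, hg0⟩ := hunst p (ε / 2) (by positivity)
    let ψ' : ℕ × ℕ → C(K, ℝ) := fun i =>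
      if hi : i ∈ s then ⟨fun x => g x (e ⟨i, hi⟩), by fun_prop⟩ else ψ i
    have hd : ∀ i, dist (ψ' i) (ψ i) ≤ ε / 2 := by
      intro i
      by_cases hi : i ∈ s
      · rw [ContinuousMap.dist_le (by positivity)]
        intro x
        have h1 : dist (g x (e ⟨i, hi⟩)) (p x (e ⟨i, hi⟩)) ≤ ε / 2 :=
          (dist_le_pi_dist _ _ _).trans ((ContinuousMap.dist_apply_le_dist x).trans hg.le)
        simpa [ψ', hi, p] using h1
      · simp only [ψ', hi, dite_false, dist_self]
        positivity
    let Ψ : E := BoundedContinuousFunction.ofNormedAddCommGroupDiscrete ψ' (‖ψ‖ + ε / 2) (by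
      intro i
      have h1 := norm_le_norm_add_norm_sub' (ψ' i) (ψ i)
      have h2 := ψ.norm_coe_le_norm i
      have h3 := hd i
      rw [dist_eq_norm] at h3
      linarith)
    refine ⟨Ψ, ?_, ?_⟩
    · have : dist Ψ ψ ≤ ε / 2 := (BoundedContinuousFunction.dist_le (by positivity)).2 hd
      rw [Metric.mem_ball]
      linarith
    · intro x hx
      obtain ⟨j, hj⟩ := Function.ne_iff.1 (hg0 x hx)
      refine ⟨(e.symm j).1, (e.symm j).2, ?_⟩
      change ψ' (e.symm j).1 x ≠ 0
      simpa [ψ'] using hj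
  have hdense := dense_iInter_of_isOpen hOopen hOdense
  let d : ℕ → K := TopologicalSpace.denseSeq K
  let q : ℕ → ℝ := fun m => 1 / ((m : ℝ) + 1)
  have hq : ∀ m, 0 < q m := fun m => by positivity
  let φ : E := BoundedContinuousFunction.ofNormedAddCommGroupDiscrete
    (fun i => (⟨fun x => min 1 (dist x (d i.1) / q i.2 - 1), by fun_prop⟩ : C(K, ℝ))) 1 (by
      intro i
      rw [ContinuousMap.norm_le _ zero_le_one]
      intro x
      have : 0 ≤ dist x (d i.1) / q i.2 := div_nonneg dist_nonneg (hq _).le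
      rw [Real.norm_eq_abs, abs_le]
      exact ⟨le_min (by norm_num) (by linarith), min_le_left _ _⟩)
  obtain ⟨ψ, hψ, hψO⟩ := Metric.dense_iff.1 hdense φ (1 / 2) (by norm_num)
  rw [Set.mem_iInter] at hψO
  have hnear : ∀ i x, |ψ i x - min 1 (dist x (d i.1) / q i.2 - 1)| < 1 / 2 := by
    intro i x
    have h1 : dist (ψ i x) (φ i x) ≤ dist ψ φ :=
      (ContinuousMap.dist_apply_le_dist x).trans (ψ.dist_coe_le_dist i)
    exact lt_of_le_of_lt h1 hψ
  refine indBelow_of_basis n (Set.univ : Set (ℕ × ℕ)) (fun i => {x : U | ψ i x < 0})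
    (fun i _ => isOpen_lt (by fun_prop) continuous_const) ?_ ?_
  · rintro ⟨y, hyU⟩ W hW hyW
    obtain ⟨W', hW', rfl⟩ := isOpen_induced_iff.1 hW
    obtain ⟨ε, hε, hball⟩ := Metric.isOpen_iff.1 hW' y hyW
    obtain ⟨m, hm⟩ := exists_nat_one_div_lt (show 0 < ε / 2 by positivity)
    change q m < ε / 2 at hm
    have hqm := hq m
    obtain ⟨k, hk⟩ := (TopologicalSpace.denseRange_denseSeq K).exists_dist_lt y
      (show 0 < q m / 2 by positivity)
    change dist y (d k) < q m / 2 at hk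
    refine ⟨(k, m), trivial, ?_, ?_⟩
    · have h1 := abs_lt.1 (hnear (k, m) y)
      have h2 : dist y (d k) / q m < 1 / 2 := by
        rw [div_lt_iff₀ hqm]; linarith
      have h3 := min_le_right 1 (dist y (d k) / q m - 1)
      simp only [Set.mem_ofPred_eq]
      simp only at h1
      linarith [h1.2]
    · rintro ⟨z, hzU⟩ hz
      refine hball ?_
      simp only [Set.mem_ofPred_eq] at hz
      have h1 := abs_lt.1 (hnear (k, m) z)
      simp only at h1
      have h2 : min 1 (dist z (d k) / q m - 1) < 1 / 2 := by linarith [h1.1]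
      have h3 : dist z (d k) / q m < 3 / 2 := by
        rcases min_lt_iff.1 h2 with h | h <;> linarith
      rw [div_lt_iff₀ hqm] at h3
      rw [Metric.mem_ball]
      linarith [dist_triangle_right z y (d k)]
  · rintro s - hs y
    obtain ⟨i, hi, hne⟩ := hψO ⟨s, hs⟩ y (subset_closure y.2)
    refine ⟨i, hi, fun hfr => hne ?_⟩
    exact frontier_lt_subset_eq (f := fun x : U => ψ i x) (g := fun _ => 0) (by fun_prop)
      continuous_const hfr

/-- Coordinatewise truncation to `[-r, r]`. -/
def truncate {n : ℕ} (r : ℝ) (v : Fin n → ℝ) : Fin n → ℝ := fun i => max (-r) (min r (v i))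

lemma continuous_truncate {n : ℕ} (r : ℝ) :
    Continuous (truncate r : (Fin n → ℝ) → Fin n → ℝ) := by
  unfold truncate
  fun_prop

lemma norm_truncate_le {n : ℕ} {r : ℝ} (hr : 0 ≤ r) (v : Fin n → ℝ) : ‖truncate r v‖ ≤ r := by
  rw [pi_norm_le_iff_of_nonneg hr]
  intro i
  rw [Real.norm_eq_abs, abs_le]
  exact ⟨le_max_left _ _, max_le (by linarith) (min_le_left _ _)⟩

lemma truncate_eq_self {n : ℕ} {r : ℝ} {v : Fin n → ℝ} (hv : ‖v‖ ≤ r) : truncate r v = v := by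
  ext i
  have h1 := abs_le.1 ((norm_le_pi_norm v i).trans hv)
  rw [truncate, min_eq_right h1.2, max_eq_right h1.1]

/-- A set of dimension at least `n` can be mapped to the cube of radius `r` in such a way that
perturbations of size `η` still cover the cube of radius `r - η`. -/
lemma exists_stable_map {K : Type u} [MetricSpace K] [CompactSpace K] {n : ℕ} {U : Set K}
    (hind : ¬ indBelow n U) {r : ℝ} (hr : 0 < r) :
    ∃ F : C(K, Fin n → ℝ), (∀ x, ‖F x‖ ≤ r) ∧ ∀ η, 0 ≤ η → ∀ g : C(K, Fin n → ℝ),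
      (∀ x ∈ closure U, ‖g x - F x‖ ≤ η) → ∀ y, ‖y‖ < r - η → ∃ x ∈ closure U, g x = y := by
  obtain ⟨p, ε, hε, hp⟩ : ∃ p : C(K, Fin n → ℝ), ∃ ε > 0, ∀ g, dist g p < ε →
      ∃ x ∈ closure U, g x = 0 := by
    by_contra! hcon
    exact hind (indBelow_of_forall_unstable n hcon)
  let p' : C(K, Fin n → ℝ) := (r / ε) • p
  have hp' : ∀ q : C(K, Fin n → ℝ), dist q p' < r → ∃ x ∈ closure U, q x = 0 := by
    intro q hq
    obtain ⟨x, hx, h0⟩ := hp ((ε / r) • q) (by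
      have h1 : p = (ε / r) • p' := by
        rw [smul_smul, div_mul_div_cancel₀ hr.ne', div_self hε.ne', one_smul]
      rw [h1, dist_eq_norm, ← smul_sub, norm_smul, ← dist_eq_norm,
        Real.norm_of_nonneg (by positivity)]
      calc ε / r * dist q p' < ε / r * r := by gcongr
        _ = ε := div_mul_cancel₀ _ hr.ne')
    refine ⟨x, hx, ?_⟩
    rw [ContinuousMap.smul_apply, smul_eq_zero] at h0
    exact h0.resolve_left (by positivity)
  refine ⟨⟨fun x => truncate r (p' x), (continuous_truncate r).comp p'.continuous⟩,
    fun x => norm_truncate_le hr.le _, ?_⟩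
  intro η hη g hg y hy
  let q : C(K, Fin n → ℝ) := p' + ⟨fun x => truncate (η + ‖y‖) (g x - y - truncate r (p' x)),
    (continuous_truncate _).comp
      ((g.continuous.sub continuous_const).sub ((continuous_truncate r).comp p'.continuous))⟩
  obtain ⟨x, hx, h0⟩ := hp' q (by
    have : dist q p' ≤ η + ‖y‖ := by
      rw [ContinuousMap.dist_le (by positivity)]
      intro x
      rw [dist_eq_norm]
      simpa [q] using norm_truncate_le (by positivity) _
    linarith)
  refine ⟨x, hx, ?_⟩
  have hgx : ‖g x - truncate r (p' x)‖ ≤ η := hg x hx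
  have h1 : truncate (η + ‖y‖) (g x - y - truncate r (p' x)) = g x - y - truncate r (p' x) := by
    apply truncate_eq_self
    rw [sub_right_comm]
    exact (norm_sub_le _ _).trans (by gcongr)
  have h2 : p' x + (g x - y - truncate r (p' x)) = 0 := by
    rw [← h1]
    exact h0
  ext i
  have h3 : p' x i + (g x i - y i - max (-r) (min r (p' x i))) = 0 := congrFun h2 i
  have h4 : |g x i - max (-r) (min r (p' x i))| ≤ η := (norm_le_pi_norm _ i).trans hgx
  have h5 : |y i| ≤ ‖y‖ := norm_le_pi_norm y i
  rw [abs_le] at h4 h5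
  rcases le_total r (p' x i) with h | h
  · rw [min_eq_left h, max_eq_right (by linarith)] at h3 h4
    linarith [h4.1, h5.2]
  · rw [min_eq_right h] at h3 h4
    rcases le_total (-r) (p' x i) with h' | h'
    · rw [max_eq_right h'] at h3
      linarith
    · rw [max_eq_left h'] at h3 h4
      linarith [h4.2, h5.1]

/-- Every map can be approximated by maps whose image is, stably under perturbation, a finite
union of cubes of the same size. -/
lemma exists_approx_stable_image {K : Type u} [MetricSpace K] [CompactSpace K] {n : ℕ}
    (hK : ∀ U : Set K, IsOpen U → U.Nonempty → ¬ indBelow n U) (f₀ : C(K, Fin n → ℝ))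
    {r : ℝ} (hr : 0 < r) :
    ∃ f : C(K, Fin n → ℝ), dist f f₀ ≤ 2 * r ∧ ∃ t : Finset (Fin n → ℝ), ∀ η, 0 ≤ η →
      ∀ g : C(K, Fin n → ℝ), dist g f ≤ η →
        (∀ x, ∃ c ∈ t, dist (g x) c ≤ r + η) ∧ ∀ c ∈ t, ball c (r - η) ⊆ Set.range g := by
  classical
  obtain ⟨s, hs⟩ : ∃ s : Finset K, ∀ z, ∃ x ∈ s, dist (f₀ z) (f₀ x) < r := by
    obtain ⟨s, hs⟩ := isCompact_univ.elim_finite_subcover (fun x : K => f₀ ⁻¹' ball (f₀ x) r)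
      (fun x => isOpen_ball.preimage f₀.continuous)
      (fun x _ => Set.mem_iUnion.2 ⟨x, mem_ball_self hr⟩)
    refine ⟨s, fun z => ?_⟩
    simpa using hs (Set.mem_univ z)
  obtain ⟨V, hV, hdisj⟩ := s.finite_toSet.t2_separation
  let U : K → Set K := fun x => V x ∩ f₀ ⁻¹' ball (f₀ x) r
  have hUo : ∀ x, IsOpen (U x) := fun x =>
    (hV x).2.inter (isOpen_ball.preimage f₀.continuous)
  have hUx : ∀ x, x ∈ U x := fun x => ⟨(hV x).1, mem_ball_self hr⟩
  have hW : ∀ x, ∃ W : Set K, IsOpen W ∧ x ∈ W ∧ closure W ⊆ U x := by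
    intro x
    obtain ⟨ε, hε, hball⟩ := Metric.isOpen_iff.1 (hUo x) x (hUx x)
    refine ⟨ball x (ε / 2), isOpen_ball, mem_ball_self (by positivity), ?_⟩
    exact closure_ball_subset_closedBall.trans
      ((closedBall_subset_ball (by linarith)).trans hball)
  choose W hWo hxW hWU using hW
  have hF := fun x => exists_stable_map (hK (W x) (hWo x) ⟨x, hxW x⟩) hr
  choose F hFr hFs using hF
  have hφ := fun x => exists_continuous_zero_one_of_isClosed (hUo x).isClosed_compl
    (isClosed_closure (s := W x)) (Set.disjoint_compl_left_iff_subset.2 (hWU x))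
  choose φ hφ0 hφ1 hφI using hφ
  let G : K → K → Fin n → ℝ := fun x z => f₀ x + F x z - f₀ z
  let f : C(K, Fin n → ℝ) :=
    ⟨fun z => f₀ z + ∑ x ∈ s, φ x z • G x z, by
      refine f₀.continuous.add (continuous_finsetSum _ fun x _ => ?_)
      exact (φ x).continuous.smul ((continuous_const.add (F x).continuous).sub f₀.continuous)⟩
  have hf_in : ∀ x ∈ s, ∀ z ∈ U x, f z = f₀ z + φ x z • G x z := by
    intro x hx z hz
    change f₀ z + ∑ x ∈ s, φ x z • G x z = _
    rw [Finset.sum_eq_single x]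
    · intro x' hx' hne
      have : z ∈ (U x')ᶜ := fun hz' =>
        Set.disjoint_left.1 (hdisj hx' hx hne) hz'.1 hz.1
      rw [hφ0 x' this, Pi.zero_apply, zero_smul]
    · exact fun h => absurd hx h
  have hf_out : ∀ z, (∀ x ∈ s, z ∉ U x) → f z = f₀ z := by
    intro z hz
    change f₀ z + ∑ x ∈ s, φ x z • G x z = _
    rw [Finset.sum_eq_zero, add_zero]
    intro x hx
    rw [hφ0 x (hz x hx), Pi.zero_apply, zero_smul]
  have hf_dist : ∀ x ∈ s, ∀ z ∈ U x, dist (f z) (f₀ x) ≤ r := by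
    intro x hx z hz
    rw [hf_in x hx z hz]
    have h1 : f₀ z ∈ closedBall (f₀ x) r := ball_subset_closedBall hz.2
    have h2 : f₀ x + F x z ∈ closedBall (f₀ x) r := by
      rw [mem_closedBall, dist_eq_norm, add_sub_cancel_left]
      exact hFr x z
    have := (convex_closedBall (f₀ x) r).add_smul_sub_mem h1 h2 (hφI x z)
    exact this
  refine ⟨f, ?_, s.image f₀, ?_⟩
  · rw [ContinuousMap.dist_le (by positivity)]
    intro z
    by_cases hz : ∃ x ∈ s, z ∈ U x
    · obtain ⟨x, hx, hzx⟩ := hz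
      have h1 := hf_dist x hx z hzx
      have h2 : dist (f₀ z) (f₀ x) < r := hzx.2
      linarith [dist_triangle_right (f z) (f₀ z) (f₀ x)]
    · push Not at hz
      rw [hf_out z hz, dist_self]
      positivity
  · intro η hη g hg
    constructor
    · intro z
      have hgz : dist (g z) (f z) ≤ η := (ContinuousMap.dist_apply_le_dist z).trans hg
      by_cases hz : ∃ x ∈ s, z ∈ U x
      · obtain ⟨x, hx, hzx⟩ := hz
        refine ⟨f₀ x, Finset.mem_image_of_mem _ hx, ?_⟩
        linarith [hf_dist x hx z hzx, dist_triangle (g z) (f z) (f₀ x)]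
      · push Not at hz
        obtain ⟨x, hx, hzx⟩ := hs z
        refine ⟨f₀ x, Finset.mem_image_of_mem _ hx, ?_⟩
        rw [hf_out z hz] at hgz
        linarith [dist_triangle (g z) (f₀ z) (f₀ x)]
    · intro c hc y hy
      obtain ⟨x, hx, rfl⟩ := Finset.mem_image.1 hc
      let g' : C(K, Fin n → ℝ) := g - ContinuousMap.const K (f₀ x)
      obtain ⟨z, -, hz⟩ := hFs x η hη g' (by
        intro z hz
        have h1 : f z = f₀ x + F x z := by
          rw [hf_in x hx z (hWU x hz), hφ1 x hz, Pi.one_apply, one_smul]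
          simp only [G]
          abel
        have h2 : g' z - F x z = g z - f z := by
          rw [h1]
          simp only [g', ContinuousMap.sub_apply, ContinuousMap.const_apply]
          abel
        rw [h2, ← dist_eq_norm]
        exact (ContinuousMap.dist_apply_le_dist z).trans hg) (y - f₀ x) (by
          rw [← dist_eq_norm]
          exact hy)
      refine ⟨z, ?_⟩
      exact sub_left_injective hz

/-- The Hausdorff pre-measure at scale `δ`. -/
noncomputable def hContent (h : ℝ≥0 → ℝ≥0) (δ : ℝ≥0) {Y : Type u} [MetricSpace Y]
    (A : Set Y) : ℝ≥0∞ :=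
  ⨅ (c : ℕ → Set Y) (_ : A ⊆ ⋃ i, c i) (_ : ∀ i, ediam (c i) ≤ (δ : ℝ≥0∞)),
    ∑' i, ((h (ediam (c i)).toNNReal : ℝ≥0) : ℝ≥0∞)

lemma hMeasure_eq_iSup_hContent (h : ℝ≥0 → ℝ≥0) {Y : Type u} [MetricSpace Y] (A : Set Y) :
    hMeasure h A = ⨆ (δ : ℝ≥0) (_ : 0 < δ), hContent h δ A := rfl

lemma hContent_anti (h : ℝ≥0 → ℝ≥0) {δ δ' : ℝ≥0} (hδ : δ ≤ δ') {Y : Type u} [MetricSpace Y]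
    (A : Set Y) : hContent h δ' A ≤ hContent h δ A :=
  iInf_mono fun _ => iInf_mono fun _ => iInf_mono' fun hc =>
    ⟨fun i => (hc i).trans (by exact_mod_cast hδ), le_rfl⟩

lemma hContent_le_card_mul {h : ℝ≥0 → ℝ≥0} (hmono : Monotone h) (h0 : h 0 = 0) {δ ρ : ℝ≥0}
    (hρ : ρ ≤ δ) {Y : Type u} [MetricSpace Y] {A : Set Y} {J : Type*} [Fintype J] (D : J → Set Y)
    (hA : A ⊆ ⋃ j, D j) (hD : ∀ j, ediam (D j) ≤ ρ) :
    hContent h δ A ≤ Fintype.card J * h ρ := by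
  let e := (Fintype.equivFin J).symm
  let c : ℕ → Set Y := fun i => if hi : i < Fintype.card J then D (e ⟨i, hi⟩) else ∅
  have hc : ∀ i, ediam (c i) ≤ ρ := by
    intro i
    by_cases hi : i < Fintype.card J
    · simpa only [c, hi, dite_true] using hD _
    · simp [c, hi]
  have hAc : A ⊆ ⋃ i, c i := by
    refine hA.trans (Set.iUnion_subset fun j => ?_)
    refine Set.subset_iUnion_of_subset (e.symm j) ?_
    simp [c]
  refine (iInf₂_le_of_le c hAc (iInf_le_of_le
    (fun i => (hc i).trans (by exact_mod_cast hρ)) le_rfl)).trans ?_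
  rw [tsum_eq_sum (s := Finset.range (Fintype.card J))]
  · calc _ ≤ ∑ i ∈ Finset.range (Fintype.card J), (h ρ : ℝ≥0∞) := by
          refine Finset.sum_le_sum fun i _ => ?_
          exact_mod_cast hmono (ENNReal.toNNReal_mono ENNReal.coe_ne_top (hc i))
      _ = _ := by simp
  · intro i hi
    have : ¬ i < Fintype.card J := by simpa using hi
    simp [c, this, h0]

lemma exists_nat_abs_sub_le {t M : ℝ} (ht0 : 0 ≤ t) {η : ℝ} (hη : 0 < η) (ht : t ≤ 2 * η * M) :
    ∃ a : Fin (⌊M⌋₊ + 1), |t - (2 * a + 1) * η| ≤ η := by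
  refine ⟨⟨⌊t / (2 * η)⌋₊, Nat.lt_succ_of_le (Nat.floor_le_floor ?_)⟩, ?_⟩
  · rw [div_le_iff₀ (by positivity)]
    linarith
  · have h1 := Nat.floor_le (show 0 ≤ t / (2 * η) by positivity)
    have h2 := Nat.lt_floor_add_one (t / (2 * η))
    rw [le_div_iff₀ (by positivity)] at h1
    rw [div_lt_iff₀ (by positivity)] at h2
    rw [abs_le]
    simp only
    constructor <;> linarith

/-- Centres of the small cubes covering a neighbourhood of the boundary of a cube. -/
def shellCenter {k : ℕ} (c : Fin (k + 1) → ℝ) (r η : ℝ) {N : ℕ}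
    (a : Fin (k + 1) × Bool × (Fin k → Fin N)) : Fin (k + 1) → ℝ :=
  c + a.1.insertNth (α := fun _ => ℝ) (if a.2.1 then r else -r)
    (fun l => (2 * (a.2.2 l : ℝ) + 1) * η - (r + η))

lemma exists_dist_shellCenter_le {k : ℕ} {c y : Fin (k + 1) → ℝ} {r η : ℝ} (hη : 0 < η)
    (hηr : η < r) (h1 : r - η ≤ dist y c) (h2 : dist y c ≤ r + η) :
    ∃ a : Fin (k + 1) × Bool × (Fin k → Fin (⌊(r + η) / η⌋₊ + 1)),
      dist y (shellCenter c r η a) ≤ η := by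
  have hy : ∀ l, |y l - c l| ≤ r + η := fun l => (dist_le_pi_dist y c l).trans h2
  obtain ⟨j, hj⟩ : ∃ j, r - η ≤ |y j - c j| := by
    by_contra! hcon
    exact absurd ((dist_pi_lt_iff (by linarith)).2 hcon) (not_lt.2 h1)
  have ha : ∀ l : Fin k, ∃ a : Fin (⌊(r + η) / η⌋₊ + 1),
      |y (j.succAbove l) - c (j.succAbove l) + (r + η) - (2 * a + 1) * η| ≤ η := by
    intro l
    have := abs_le.1 (hy (j.succAbove l))
    refine exists_nat_abs_sub_le (by linarith) hη ?_
    rw [mul_assoc, mul_div_cancel₀ _ hη.ne']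
    linarith
  choose a ha using ha
  refine ⟨(j, decide (0 ≤ y j - c j), a), ?_⟩
  rw [dist_pi_le_iff hη.le, Fin.forall_iff_succAbove j]
  constructor
  · have hyj := hy j
    rw [Real.dist_eq]
    simp only [shellCenter, Pi.add_apply, Fin.insertNth_apply_same, decide_eq_true_eq]
    split_ifs with hs
    · rw [abs_of_nonneg hs] at hj hyj
      rw [abs_le]
      constructor <;> linarith
    · rw [abs_of_neg (not_le.1 hs)] at hj hyj
      rw [abs_le]
      constructor <;> linarith
  · intro l
    rw [Real.dist_eq]
    simp only [shellCenter, Pi.add_apply, Fin.insertNth_apply_succAbove]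
    convert ha l using 2
    ring

/-- The boundary of a set squeezed between finite unions of cubes of radii `r - η` and `r + η`
has small Hausdorff pre-measure. -/
lemma hContent_frontier_le {h : ℝ≥0 → ℝ≥0} (hmono : Monotone h) (h0 : h 0 = 0) {k : ℕ}
    {A : Set (Fin (k + 1) → ℝ)} (hA : IsClosed A) (t : Finset (Fin (k + 1) → ℝ)) {r : ℝ}
    {η δ : ℝ≥0} (hη : 0 < η) (hηr : η < r) (hηδ : 2 * η ≤ δ)
    (hout : ∀ y ∈ A, ∃ c ∈ t, dist y c ≤ r + η) (hin : ∀ c ∈ t, ball c (r - η) ⊆ A)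
    {e : ℝ} (he : (h (2 * η) : ℝ) ≤ e * (2 * η : ℝ) ^ k) :
    hContent h δ (frontier A) ≤
      ENNReal.ofReal (t.card * ((k + 1) * (2 * (6 * r) ^ k)) * e) := by
  have hη' : (0 : ℝ) < η := hη
  have hr : 0 < r := hη'.trans hηr
  let N := ⌊(r + η) / η⌋₊ + 1
  let D : t × (Fin (k + 1) × Bool × (Fin k → Fin N)) → Set (Fin (k + 1) → ℝ) :=
    fun a => closedBall (shellCenter a.1.1 r η a.2) η
  have hcov : frontier A ⊆ ⋃ a, D a := by
    intro y hy
    rw [hA.frontier_eq] at hy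
    obtain ⟨c, hc, hyc⟩ := hout y hy.1
    have h1 : r - η ≤ dist y c := by
      by_contra! hlt
      exact hy.2 (interior_maximal (hin c hc) isOpen_ball hlt)
    obtain ⟨a, ha⟩ := exists_dist_shellCenter_le hη' hηr h1 hyc
    exact Set.mem_iUnion.2 ⟨(⟨c, hc⟩, a), ha⟩
  have hdiam : ∀ a, ediam (D a) ≤ ((2 * η : ℝ≥0) : ℝ≥0∞) := by
    intro a
    simp only [D]
    rw [← closedEBall_coe]
    push_cast
    exact ediam_closedEBall_le
  refine (hContent_le_card_mul hmono h0 hηδ D hcov hdiam).trans ?_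
  have hN : (N : ℝ) ≤ 3 * r / η := by
    have h1 := Nat.floor_le (show 0 ≤ (r + η) / η by positivity)
    have h2 : (r + η) / η + 1 ≤ 3 * r / η := by
      rw [div_add_one hη'.ne']
      gcongr
      linarith
    simp only [N]
    push_cast
    linarith
  have hcard : (Fintype.card (t × (Fin (k + 1) × Bool × (Fin k → Fin N))) : ℝ) * h (2 * η) ≤
      t.card * ((k + 1) * (2 * (6 * r) ^ k)) * e := by
    have h1 : (N : ℝ) ^ k * h (2 * η) ≤ (6 * r) ^ k * e := by
      calc (N : ℝ) ^ k * h (2 * η) ≤ (3 * r / η) ^ k * (e * (2 * η : ℝ) ^ k) := by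
            gcongr
        _ = (3 * r / η * (2 * η)) ^ k * e := by rw [mul_pow _ (2 * (η : ℝ))]; ring
        _ = (6 * r) ^ k * e := by
            congr 2
            rw [div_mul_eq_mul_div]
            field_simp
            norm_num
    simp only [Fintype.card_prod, Fintype.card_coe, Fintype.card_fin, Fintype.card_bool,
      Fintype.card_pi, Finset.prod_const, Finset.card_univ]
    push_cast
    calc _ = (t.card : ℝ) * ((k + 1) * 2) * ((N : ℝ) ^ k * h (2 * η)) := by ring
      _ ≤ (t.card : ℝ) * ((k + 1) * 2) * ((6 * r) ^ k * e) := by gcongr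
      _ = _ := by ring
  calc _ = ENNReal.ofReal
        ((Fintype.card (t × (Fin (k + 1) × Bool × (Fin k → Fin N))) : ℝ) * h (2 * η)) := by
        rw [ENNReal.ofReal_mul (by positivity), ENNReal.ofReal_natCast,
          ENNReal.ofReal_coe_nnreal]
    _ ≤ _ := ENNReal.ofReal_le_ofReal hcard

/-- A gauge function `h` with `h r / r ^ k → 0` satisfies `h r ≤ e * r ^ k` for small `r`. -/
lemma exists_forall_le_mul_pow_of_tendsto_div_pow {h : ℝ≥0 → ℝ≥0} {k : ℕ}
    (hlim : Filter.Tendsto (fun r : ℝ≥0 => (h r : ℝ) / (r : ℝ) ^ k)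
      (nhdsWithin 0 (Set.Ioi 0)) (nhds 0)) {e : ℝ} (he : 0 < e) :
    ∃ ρ₀ > 0, ∀ ρ, 0 < ρ → ρ < ρ₀ → (h ρ : ℝ) ≤ e * (ρ : ℝ) ^ k := by
  obtain ⟨ρ₀, hρ₀, hsub⟩ := (mem_nhdsGT_iff_exists_Ioo_subset).1
    (hlim.eventually (Iio_mem_nhds he))
  refine ⟨ρ₀, hρ₀, fun ρ h1 h2 => ?_⟩
  have h3 : (h ρ : ℝ) / (ρ : ℝ) ^ k < e := hsub ⟨h1, h2⟩
  have h4 : (0 : ℝ) < ρ := h1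
  rw [div_lt_iff₀ (by positivity)] at h3
  exact h3.le

lemma map_zero_of_tendsto_div_pow {h : ℝ≥0 → ℝ≥0} (hmono : Monotone h) {k : ℕ}
    (hlim : Filter.Tendsto (fun r : ℝ≥0 => (h r : ℝ) / (r : ℝ) ^ k)
      (nhdsWithin 0 (Set.Ioi 0)) (nhds 0)) : h 0 = 0 := by
  by_contra hne
  have hpos : (0 : ℝ) < h 0 := NNReal.coe_pos.2 (pos_iff_ne_zero.2 hne)
  obtain ⟨ρ₀, hρ₀, hρ⟩ := exists_forall_le_mul_pow_of_tendsto_div_pow hlim (half_pos hpos)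
  obtain ⟨ρ, h1, h2⟩ := exists_between (lt_min hρ₀ one_pos)
  have h3 := hρ ρ h1 (h2.trans_le (min_le_left _ _))
  have h4 : (ρ : ℝ) ^ k ≤ 1 :=
    pow_le_one₀ ρ.2 (by exact_mod_cast (h2.trans_le (min_le_right _ _)).le)
  have h5 : (h 0 : ℝ) ≤ h ρ := by exact_mod_cast hmono ρ.2
  nlinarith

/-- Generically, the boundary of the image has Hausdorff pre-measure at most `δ` at scale `δ`. -/
lemma eventually_residual_hContent_frontier_le {h : ℝ≥0 → ℝ≥0} (hmono : Monotone h) {k : ℕ}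
    (hlim : Filter.Tendsto (fun r : ℝ≥0 => (h r : ℝ) / (r : ℝ) ^ k)
      (nhdsWithin 0 (Set.Ioi 0)) (nhds 0)) {K : Type u} [MetricSpace K] [CompactSpace K]
    (hK : ∀ U : Set K, IsOpen U → U.Nonempty → ¬ indBelow (k + 1) U) {δ : ℝ≥0} (hδ : 0 < δ) :
    ∀ᶠ f : C(K, Fin (k + 1) → ℝ) in residual C(K, Fin (k + 1) → ℝ),
      hContent h δ (frontier (Set.range f)) ≤ δ := by
  let S : Set C(K, Fin (k + 1) → ℝ) := {f | hContent h δ (frontier (Set.range f)) ≤ δ}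
  refine Filter.mem_of_superset (residual_of_dense_open (isOpen_interior (s := S)) ?_)
    interior_subset
  rw [Metric.dense_iff]
  intro f₀ ε hε
  have hr : 0 < ε / 4 := by positivity
  obtain ⟨f, hf, t, ht⟩ := exists_approx_stable_image hK f₀ hr
  set r := ε / 4 with hrε
  refine ⟨f, ?_, ?_⟩
  · rw [Metric.mem_ball]
    linarith
  let C : ℝ := t.card * ((k + 1) * (2 * (6 * r) ^ k))
  have hC : 0 ≤ C := by positivity
  have hδ' : (0 : ℝ) < δ := hδ
  have he : 0 < δ / (C + 1) := by positivity
  obtain ⟨ρ₀, hρ₀, hρ⟩ := exists_forall_le_mul_pow_of_tendsto_div_pow hlim he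
  obtain ⟨η, hη0, hη⟩ := exists_between (show
    (0 : ℝ≥0) < min (min (ρ₀ / 2) (δ / 2)) ⟨r, hr.le⟩ from
      lt_min (lt_min (half_pos hρ₀) (half_pos hδ)) hr)
  have hη1 : η < ρ₀ / 2 := hη.trans_le ((min_le_left _ _).trans (min_le_left _ _))
  have hη2 : η < δ / 2 := hη.trans_le ((min_le_left _ _).trans (min_le_right _ _))
  have hη3 : (η : ℝ) < r := hη.trans_le (min_le_right _ _)
  rw [lt_div_iff₀' two_pos] at hη1 hη2
  refine mem_interior.2 ⟨ball f η, fun g hg => ?_, isOpen_ball, mem_ball_self hη0⟩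
  obtain ⟨hout, hin⟩ := ht η η.2 g (mem_ball.1 hg).le
  refine (hContent_frontier_le hmono (map_zero_of_tendsto_div_pow hmono hlim)
    (isCompact_range g.continuous).isClosed t hη0 hη3 hη2.le
    (by rintro _ ⟨x, rfl⟩; exact hout x) hin
    (by simpa using hρ (2 * η) (by positivity) hη1)).trans ?_
  rw [← ENNReal.ofReal_coe_nnreal]
  refine ENNReal.ofReal_le_ofReal ?_
  change C * (δ / (C + 1)) ≤ δ
  rw [mul_div_assoc', div_le_iff₀ (by positivity)]
  nlinarith

/-- If every non-empty open subset of `K` has topological dimension at least `n` and `h` is a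
gauge function with `h(r)/r^{n-1} → 0`, then the boundary of a generic image has zero `ℋ^h`
measure. -/
theorem stmt19 (n : ℕ) (hn : 0 < n) (K : Type*) [MetricSpace K] [CompactSpace K]
    (hK : ∀ U : Set K, IsOpen U → U.Nonempty → (n : EReal) ≤ tdim U)
    (h : ℝ≥0 → ℝ≥0) (hmono : Monotone h)
    (hlim : Filter.Tendsto (fun r : ℝ≥0 => (h r : ℝ) / (r : ℝ) ^ ((n : ℝ) - 1))
      (nhdsWithin 0 (Set.Ioi 0)) (nhds 0)) :
    ∀ᶠ (f : C(K, Fin n → ℝ)) in residual C(K, Fin n → ℝ), hMeasure h (frontier (Set.range ⇑f)) = 0 := by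
  obtain ⟨k, rfl⟩ : ∃ k, n = k + 1 := ⟨n - 1, by omega⟩
  have hlim' : Filter.Tendsto (fun r : ℝ≥0 => (h r : ℝ) / (r : ℝ) ^ k)
      (nhdsWithin 0 (Set.Ioi 0)) (nhds 0) := by
    refine hlim.congr fun r => ?_
    rw [Nat.cast_add_one, add_sub_cancel_right, Real.rpow_natCast]
  have hall : ∀ᶠ f : C(K, Fin (k + 1) → ℝ) in residual C(K, Fin (k + 1) → ℝ), ∀ m : ℕ,
      hContent h (1 / ((m : ℝ≥0) + 1)) (frontier (Set.range f)) ≤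
        (1 / ((m : ℝ≥0) + 1) : ℝ≥0) :=
    eventually_countable_forall.2 fun m =>
      eventually_residual_hContent_frontier_le hmono hlim'
        (fun U hU hne => not_indBelow_of_le_tdim (hK U hU hne)) (by positivity)
  filter_upwards [hall] with f hf
  rw [hMeasure_eq_iSup_hContent, ← nonpos_iff_eq_zero]
  refine iSup₂_le fun δ hδ => ENNReal.le_of_forall_pos_le_add fun ε hε _ => ?_
  obtain ⟨m, hm⟩ := exists_nat_one_div_lt (lt_min hδ hε)
  rw [zero_add]
  calc hContent h δ (frontier (Set.range f))
      ≤ hContent h (1 / ((m : ℝ≥0) + 1)) (frontier (Set.range f)) :=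
        hContent_anti h (hm.le.trans (min_le_left _ _)) _
    _ ≤ (1 / ((m : ℝ≥0) + 1) : ℝ≥0) := hf m
    _ ≤ ε := by exact_mod_cast hm.le.trans (min_le_right _ _)
end
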